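/- Let the delayed mass-action system be a DeCBMAS and let W be a semilocking set. Let 𝒮̃ = span_ℝ{ π_W(y'_i − y_i) : 1 ≤ i ≤ r } ⊆ ℝ^W, where π_W denotes the coordinate projection onto the coordinates in W (this is the stoichiometric subspace of the reduced system on W). If dim 𝒮̃ < |W|, then no ω-limit point of any bounded solution with positive initial condition lies on the boundary L_W. -/

import Mathlib

open Finset Filter

variable {n r : ℕ}

/-- Mass-action monomial `x^y = ∏ j, x j ^ y j`. -/
def mono (x : Fin n → ℝ) (y : Fin n → ℕ) : ℝ := ∏ j, x j ^ y j

/-- A (bounded-domain) solution of the delayed mass-action system whose reactions are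
those in the index set `R` (with reactant complexes `y`, product complexes `y'`,
rate constants `k`, delays `τ`, and maximal delay `τm`):
nonnegative, continuous on `[-τm, ∞)`, and satisfying the delay differential equation
`x'(t) = ∑ i ∈ R, k i (x(t-τ i)^{y i} • y' i - x(t)^{y i} • y i)` for `t > 0`. -/
def IsSolutionOn (y y' : Fin r → Fin n → ℕ) (k τ : Fin r → ℝ) (τm : ℝ)
    (R : Finset (Fin r)) (x : ℝ → Fin n → ℝ) : Prop :=
  (∀ t ∈ Set.Ici (-τm), ∀ j, 0 ≤ x t j) ∧
  ContinuousOn x (Set.Ici (-τm)) ∧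
  ∀ t > (0 : ℝ), HasDerivAt x
    (fun j => ∑ i ∈ R, k i * (mono (x (t - τ i)) (y i) * (y' i j : ℝ)
      - mono (x t) (y i) * (y i j : ℝ))) t

/-- A solution of the full delayed mass-action system. -/
def IsSolution (y y' : Fin r → Fin n → ℕ) (k τ : Fin r → ℝ) (τm : ℝ)
    (x : ℝ → Fin n → ℝ) : Prop :=
  IsSolutionOn y y' k τ τm Finset.univ x

/-- Positive initial condition: `x` is strictly positive on `[-τm, 0]`. -/
def PosInit (τm : ℝ) (x : ℝ → Fin n → ℝ) : Prop :=
  ∀ t ∈ Set.Icc (-τm) 0, ∀ j, 0 < x t j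

/-- The solution is bounded on `[-τm, ∞)`. -/
def BoundedSol (τm : ℝ) (x : ℝ → Fin n → ℝ) : Prop :=
  ∃ M : ℝ, ∀ t ∈ Set.Ici (-τm), ‖x t‖ ≤ M

/-- The (sub)system consisting of the reactions in `R` is complex balanced:
there is a positive state `xb` at which, for every complex `η`, the inflow and
outflow rates of `η` coincide. -/
def ComplexBalancedOn (y y' : Fin r → Fin n → ℕ) (k : Fin r → ℝ)
    (R : Finset (Fin r)) : Prop :=
  ∃ xb : Fin n → ℝ, (∀ j, 0 < xb j) ∧ ∀ η : Fin n → ℕ,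
    ∑ i ∈ R.filter (fun i => y i = η), k i * mono xb (y i)
      = ∑ i ∈ R.filter (fun i => y' i = η), k i * mono xb (y i)

/-- `W` is a semilocking set for the reactions in `R`. -/
def Semilocking (y y' : Fin r → Fin n → ℕ) (R : Finset (Fin r)) (W : Set (Fin n)) : Prop :=
  W.Nonempty ∧ ∀ i ∈ R, (∃ j ∈ W, y' i j ≠ 0) → ∃ j ∈ W, y i j ≠ 0

/-- Stoichiometric subspace spanned by the reaction vectors of the reactions in `R`. -/
def stoichOn (y y' : Fin r → Fin n → ℕ) (R : Finset (Fin r)) : Submodule ℝ (Fin n → ℝ) :=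
  Submodule.span ℝ {v | ∃ i ∈ R, v = fun j => (y' i j : ℝ) - (y i j : ℝ)}

/-- `W` is vertex-type w.r.t. the subspace `V`: the only `v ∈ V` vanishing on `W` is `0`. -/
def VertexType (V : Submodule ℝ (Fin n → ℝ)) (W : Set (Fin n)) : Prop :=
  ∀ v ∈ V, (∀ j ∈ W, v j = 0) → v = 0

/-- `W` is facet-type w.r.t. the subspace `V`: the projection of `V` onto the
coordinates outside `W` has dimension `dim V - 1`. -/
def FacetType (V : Submodule ℝ (Fin n → ℝ)) (W : Set (Fin n)) : Prop :=
  Module.finrank ℝ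
      (V.map (LinearMap.funLeft ℝ ℝ (Subtype.val : {j : Fin n // j ∉ W} → Fin n)))
    = Module.finrank ℝ V - 1

/-- The network is a combination of subnetworks with species sets `Sp p` and with
reaction `i` assigned to subnetwork `grp i`. -/
def IsCombination {l : ℕ} (y y' : Fin r → Fin n → ℕ) (Sp : Fin l → Set (Fin n))
    (grp : Fin r → Fin l) : Prop :=
  (∀ j, ∃ p, j ∈ Sp p) ∧ ∀ i j, (y i j ≠ 0 ∨ y' i j ≠ 0) → j ∈ Sp (grp i)

/-- The reaction index set of subnetwork `p`. -/
def Rgrp {l : ℕ} (grp : Fin r → Fin l) (p : Fin l) : Finset (Fin r) :=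
  Finset.univ.filter (fun i => grp i = p)

/-- The set `S_c` of intersecting species. -/
def interSpecies {l : ℕ} (Sp : Fin l → Set (Fin n)) : Set (Fin n) :=
  {j | ∃ p q, p ≠ q ∧ j ∈ Sp p ∧ j ∈ Sp q}

/-- `W^{cn}`: species outside `W` lying in some subnetwork `p'` with `W ∩ S^(p') = ∅`. -/
def Wcn {l : ℕ} (Sp : Fin l → Set (Fin n)) (W : Set (Fin n)) : Set (Fin n) :=
  {j | j ∉ W ∧ ∃ p, W ∩ Sp p = ∅ ∧ j ∈ Sp p}

/-- `W^{tf}`: completely unrestricted species outside `W`: they occur in some reaction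
all of whose species lie outside `W`. -/
def Wtf (y y' : Fin r → Fin n → ℕ) (W : Set (Fin n)) : Set (Fin n) :=
  {j | j ∉ W ∧ ∃ i, (y i j ≠ 0 ∨ y' i j ≠ 0) ∧
    ∀ j', (y i j' ≠ 0 ∨ y' i j' ≠ 0) → j' ∉ W}

/-- `W^{tr}`: totally restricted species outside `W`: every stoichiometric vector
vanishing on `W` also vanishes at `j`. -/
def Wtr (y y' : Fin r → Fin n → ℕ) (W : Set (Fin n)) : Set (Fin n) :=
  {j | j ∉ W ∧ ∀ v ∈ stoichOn y y' Finset.univ, (∀ j' ∈ W, v j' = 0) → v j = 0}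

/-- `θ` (a function on `[-τm,0]`) is an ω-limit point of the solution `x`. -/
def OmegaLimitPt (τm : ℝ) (x θ : ℝ → Fin n → ℝ) : Prop :=
  ContinuousOn θ (Set.Icc (-τm) 0) ∧ (∀ s ∈ Set.Icc (-τm) 0, ∀ j, 0 ≤ θ s j) ∧
  ∃ tN : ℕ → ℝ, Tendsto tN atTop atTop ∧
    ∀ ε > (0 : ℝ), ∃ N₀, ∀ N ≥ N₀, ∀ s ∈ Set.Icc (-τm) 0, ‖x (tN N + s) - θ s‖ < ε

/-- `θ` lies on the boundary `L_W`: it vanishes identically on the coordinates of `W`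
and is nowhere zero on the coordinates outside `W`. -/
def OnBoundary (τm : ℝ) (W : Set (Fin n)) (θ : ℝ → Fin n → ℝ) : Prop :=
  (∀ s ∈ Set.Icc (-τm) 0, ∀ j ∈ W, θ s j = 0) ∧
  ∀ s ∈ Set.Icc (-τm) 0, ∀ j ∉ W, θ s j ≠ 0

/-- Persistence of the delayed mass-action system: every bounded solution with
positive initial condition has `liminf_{t→∞} x_j(t) > 0` for every species `j`. -/
def Persistent (y y' : Fin r → Fin n → ℕ) (k τ : Fin r → ℝ) (τm : ℝ) : Prop :=
  ∀ x : ℝ → Fin n → ℝ, IsSolution y y' k τ τm x → PosInit τm x → BoundedSol τm x →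
    ∀ j, 0 < liminf (fun t => x t j) atTop


open Finset Filter

namespace GP

structure Par where
  n : ℕ
  N0 : ℕ
  s : ℝ
  L : ℝ
  c1 : ℝ
  K : ℝ
  hn : 1 ≤ n
  hN0 : 1 ≤ N0

namespace Par

def Nrec (N0 : ℕ) : ℕ → ℕ
  | 0 => N0
  | h + 1 => 2 * (Nrec N0 h) ^ 2

def Nf (P : Par) (h : ℕ) : ℕ := Nrec P.N0 h

def Nb (P : Par) : ℕ := P.Nf P.n

end Par

/-- integer combinations -/
noncomputable def combos (M : ℕ) : List ℝ → Finset ℝ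
  | [] => {0}
  | v :: p => ((Finset.Icc (-(M : ℤ)) M) ×ˢ combos M p).image (fun ay => (ay.1 : ℝ) * v + ay.2)

theorem mem_combos_cons {M : ℕ} {v : ℝ} {p : List ℝ} {x : ℝ} :
    x ∈ combos M (v :: p) ↔ ∃ a : ℤ, |a| ≤ M ∧ ∃ y ∈ combos M p, x = a * v + y := by
  simp only [combos, Finset.mem_image, Finset.mem_product, Finset.mem_Icc, Prod.exists, abs_le]
  constructor
  · rintro ⟨a, y, ⟨ha, hy⟩, rfl⟩
    exact ⟨a, ha, y, hy, rfl⟩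
  · rintro ⟨a, ha, y, hy, rfl⟩
    exact ⟨a, y, ⟨ha, hy⟩, rfl⟩

theorem combos_zero (M : ℕ) (p : List ℝ) : (0 : ℝ) ∈ combos M p := by
  induction p with
  | nil => simp [combos]
  | cons v p ih => exact mem_combos_cons.2 ⟨0, by simp, 0, ih, by simp⟩

theorem combos_mono {M M' : ℕ} (h : M ≤ M') {p : List ℝ} {x : ℝ} (hx : x ∈ combos M p) :
    x ∈ combos M' p := by
  induction p generalizing x with
  | nil => simpa [combos] using hx
  | cons v p ih =>
    obtain ⟨a, ha, y, hy, rfl⟩ := mem_combos_cons.1 hx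
    exact mem_combos_cons.2 ⟨a, ha.trans (by exact_mod_cast h), y, ih hy, rfl⟩

theorem combos_add {M M' : ℕ} {p : List ℝ} {x x' : ℝ} (hx : x ∈ combos M p)
    (hx' : x' ∈ combos M' p) : x + x' ∈ combos (M + M') p := by
  induction p generalizing x x' with
  | nil =>
    simp only [combos, Finset.mem_singleton] at *
    simp [hx, hx']
  | cons v p ih =>
    obtain ⟨a, ha, y, hy, rfl⟩ := mem_combos_cons.1 hx
    obtain ⟨a', ha', y', hy', rfl⟩ := mem_combos_cons.1 hx'
    refine mem_combos_cons.2 ⟨a + a', ?_, y + y', ih hy hy', by push_cast; ring⟩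
    push_cast
    exact (abs_add_le _ _).trans (add_le_add ha ha')

theorem combos_smul {M : ℕ} {m : ℕ} {c : ℤ} (hc : |c| ≤ m) {p : List ℝ} {x : ℝ}
    (hx : x ∈ combos M p) : (c : ℝ) * x ∈ combos (m * M) p := by
  induction p generalizing x with
  | nil =>
    simp only [combos, Finset.mem_singleton] at *
    simp [hx]
  | cons v p ih =>
    obtain ⟨a, ha, y, hy, rfl⟩ := mem_combos_cons.1 hx
    refine mem_combos_cons.2 ⟨c * a, ?_, c * y, ih hy, by push_cast; ring⟩
    rw [abs_mul]; push_cast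
    exact mul_le_mul hc ha (abs_nonneg _) (by positivity)

theorem combos_neg {M : ℕ} {p : List ℝ} {x : ℝ}
    (hx : x ∈ combos M p) : -x ∈ combos M p := by
  have := combos_smul (m := 1) (c := -1) (by simp) hx
  simpa using this

theorem combos_head {M : ℕ} (hM : 1 ≤ M) (p : List ℝ) : p.headD 0 ∈ combos M p := by
  cases p with
  | nil => simp [combos]
  | cons v p =>
    exact mem_combos_cons.2 ⟨1, by simpa using hM, 0, combos_zero _ _, by simp⟩

theorem card_combos (M : ℕ) (p : List ℝ) : (combos M p).card ≤ (2 * M + 1) ^ p.length := by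
  induction p with
  | nil => simp [combos]
  | cons v p ih =>
    refine Finset.card_image_le.trans ?_
    rw [Finset.card_product, List.length_cons, pow_succ, mul_comm]
    refine Nat.mul_le_mul ih ?_
    simp; omega

namespace Par
variable (P : Par)

noncomputable def walls (p : List ℝ) : Finset ℝ :=
  ((Finset.Icc 1 (P.Nf (P.n - p.length))) ×ˢ combos (P.Nf (P.n - p.length)) p).image
    (fun cy => cy.2 / (cy.1 : ℝ))

theorem mem_walls {p : List ℝ} {w : ℝ} : w ∈ P.walls p ↔ ∃ c : ℕ, 1 ≤ c ∧
    c ≤ P.Nf (P.n - p.length) ∧ ∃ y ∈ combos (P.Nf (P.n - p.length)) p, w = y / c := by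
  simp only [walls, Finset.mem_image, Finset.mem_product, Finset.mem_Icc, Prod.exists]
  constructor
  · rintro ⟨a, y, ⟨ha, hy⟩, rfl⟩
    exact ⟨a, ha.1, ha.2, y, hy, rfl⟩
  · rintro ⟨a, ha, ha', y, hy, rfl⟩
    exact ⟨a, y, ⟨⟨ha, ha'⟩, hy⟩, rfl⟩

theorem Nf_pos (h : ℕ) : 1 ≤ P.Nf h := by
  unfold Nf
  induction h with
  | zero => exact P.hN0
  | succ h ih => simp only [Nrec]; nlinarith

theorem Nf_succ (h : ℕ) : P.Nf (h + 1) = 2 * (P.Nf h) ^ 2 := rfl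

theorem Nf_le_succ (h : ℕ) : P.Nf h ≤ P.Nf (h + 1) := by
  rw [Nf_succ]; have := P.Nf_pos h; nlinarith

theorem Nf_mono : Monotone P.Nf := monotone_nat_of_le_succ P.Nf_le_succ

theorem N0_le (h : ℕ) : P.N0 ≤ P.Nf h := P.Nf_mono (Nat.zero_le h)

theorem head_mem_walls (p : List ℝ) : p.headD 0 ∈ P.walls p :=
  P.mem_walls.2 ⟨1, le_rfl, P.Nf_pos _, _, combos_head (P.Nf_pos _) p, by simp⟩

theorem zero_mem_walls (p : List ℝ) : (0 : ℝ) ∈ P.walls p :=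
  P.mem_walls.2 ⟨1, le_rfl, P.Nf_pos _, 0, combos_zero _ _, by simp⟩

theorem walls_nil {w : ℝ} (h : w ∈ P.walls []) : w = 0 := by
  obtain ⟨c, _, _, y, hy, rfl⟩ := P.mem_walls.1 h
  simp only [combos, Finset.mem_singleton] at hy
  simp [hy]

theorem card_walls (p : List ℝ) (hp : p.length ≤ P.n) :
    (P.walls p).card ≤ P.Nb * (2 * P.Nb + 1) ^ P.n := by
  refine Finset.card_image_le.trans ?_
  rw [Finset.card_product]
  have h1 : P.Nf (P.n - p.length) ≤ P.Nb := P.Nf_mono (Nat.sub_le _ _)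
  refine Nat.mul_le_mul (by simpa using h1) ((card_combos _ _).trans ?_)
  calc _ ≤ (2 * P.Nb + 1) ^ p.length := Nat.pow_le_pow_left (by omega) _
    _ ≤ _ := Nat.pow_le_pow_right (by omega) hp

/-- scale -/
noncomputable def Sc : List ℝ → ℝ
  | [] => P.s * P.L ^ (2 ^ P.n)
  | v :: p => if v ∈ P.walls p then Sc p * P.L ^ (2 ^ (P.n - (p.length + 1)))
      else Sc p / P.L ^ (2 ^ (P.n - (p.length + 1)))

noncomputable def Uu (p : List ℝ) : ℝ := P.Sc p * P.L ^ (2 ^ (P.n - p.length))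
noncomputable def Ll (p : List ℝ) : ℝ := P.Sc p / P.L ^ (2 ^ (P.n - p.length))

def Adm (p : List ℝ) (v : ℝ) : Prop :=
  p.headD 0 ≤ v ∧ (v ∈ P.walls p ∨ ((∃ z : ℤ, v = z) ∧ ∀ w ∈ P.walls p, P.Sc p ≤ |v - w|))

def Legit : List ℝ → Prop
  | [] => True
  | v :: p => Legit p ∧ P.Adm p v

structure Good : Prop where
  s10 : 10 ≤ P.s
  L1 : 10 * (P.Nb : ℝ) ^ (P.n + 2) ≤ P.L
  L2 : 32 * P.n * P.N0 ≤ P.L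
  c1s : 32 * P.n * P.N0 * P.c1 ≤ P.s
  c1e : 20 * (P.n : ℝ) ≤ Real.exp P.c1
  hK : P.K ≤ P.s
  T1 : ∀ T, P.s ≤ T → 2 * P.n * (T + 1) * Real.exp (-T) ≤ 1 / 10
  T2 : ∀ T, P.s ≤ T → (P.Nb * (2 * P.Nb + 1) ^ P.n : ℕ) * Real.exp (-(8 * T)) ≤ 1 / 2

variable {P}

theorem Good.Lpos (G : P.Good) : 10 ≤ P.L := by
  have h := G.L1
  have h1 : (1 : ℝ) ≤ (P.Nb : ℝ) ^ (P.n + 2) :=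
    one_le_pow₀ (by exact_mod_cast P.Nf_pos _)
  linarith

theorem Good.Lpow (G : P.Good) (m : ℕ) : P.L ≤ P.L ^ (2 ^ m) := by
  have := G.Lpos
  exact le_self_pow₀ (by linarith) (by positivity)

theorem Sc_pos (G : P.Good) (p : List ℝ) : 0 < P.Sc p := by
  have hL := G.Lpos
  have hs := G.s10
  have hLp : 0 < P.L := by linarith
  induction p with
  | nil => simp only [Sc]; positivity
  | cons v p ih => simp only [Sc]; split_ifs <;> positivity

theorem pow_split (p : List ℝ) (hp : p.length < P.n) :
    P.L ^ (2 ^ (P.n - p.length)) =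
    P.L ^ (2 ^ (P.n - (p.length + 1))) * P.L ^ (2 ^ (P.n - (p.length + 1))) := by
  have : P.n - p.length = (P.n - (p.length + 1)) + 1 := by omega
  rw [this, pow_succ, mul_two, pow_add]

theorem Uu_wall {v : ℝ} {p : List ℝ} (hp : p.length < P.n) (hv : v ∈ P.walls p) :
    P.Uu (v :: p) = P.Uu p := by
  simp only [Uu, Sc, if_pos hv, List.length_cons]
  rw [pow_split p hp]; ring

theorem Uu_free (G : P.Good) {v : ℝ} {p : List ℝ} (hv : v ∉ P.walls p) :
    P.Uu (v :: p) = P.Sc p := by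
  have hL := G.Lpos
  have hLp : 0 < P.L := by linarith
  simp only [Uu, Sc, if_neg hv, List.length_cons]
  field_simp

theorem Ll_wall (G : P.Good) {v : ℝ} {p : List ℝ} (hv : v ∈ P.walls p) :
    P.Ll (v :: p) = P.Sc p := by
  have hL := G.Lpos
  have hLp : 0 < P.L := by linarith
  simp only [Ll, Sc, if_pos hv, List.length_cons]
  field_simp

theorem Ll_free {v : ℝ} {p : List ℝ} (hp : p.length < P.n) (hv : v ∉ P.walls p) :
    P.Ll (v :: p) = P.Ll p := by
  simp only [Ll, Sc, if_neg hv, List.length_cons]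
  rw [pow_split p hp, div_div]

theorem Uu_ge (G : P.Good) (p : List ℝ) : P.Sc p * P.L ≤ P.Uu p := by
  have := Sc_pos G p
  exact mul_le_mul_of_nonneg_left (G.Lpow _) this.le

theorem Ll_le (G : P.Good) (p : List ℝ) : P.Ll p ≤ P.Sc p / P.L := by
  have := Sc_pos G p
  have hL := G.Lpos
  have := G.Lpow (P.n - p.length)
  unfold Ll
  gcongr

theorem Ll_le_Sc (G : P.Good) (p : List ℝ) : P.Ll p ≤ P.Sc p := by
  refine (Ll_le G p).trans ?_
  have := Sc_pos G p
  have hL := G.Lpos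
  exact div_le_self this.le (by linarith)

theorem Uu_cons_le (G : P.Good) {v : ℝ} {p : List ℝ} (hp : p.length < P.n) : P.Uu (v :: p) ≤ P.Uu p := by
  by_cases hv : v ∈ P.walls p
  · rw [Uu_wall hp hv]
  · rw [Uu_free G hv]
    refine le_trans ?_ (Uu_ge G p)
    have := Sc_pos G p
    have hL := G.Lpos
    nlinarith

theorem Ll_cons_ge (G : P.Good) {v : ℝ} {p : List ℝ} (hp : p.length < P.n) : P.Ll p ≤ P.Ll (v :: p) := by
  by_cases hv : v ∈ P.walls p
  · rw [Ll_wall G hv]; exact Ll_le_Sc G p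
  · rw [Ll_free hp hv]

theorem s_le_Ll (G : P.Good) (p : List ℝ) (hp : p.length ≤ P.n) : P.s ≤ P.Ll p := by
  induction p with
  | nil =>
    have hL := G.Lpos
    have hLp : 0 < P.L := by linarith
    simp only [Ll, Sc, List.length_nil, Nat.sub_zero]
    rw [mul_div_assoc, div_self (by positivity), mul_one]
  | cons v p ih =>
    simp only [List.length_cons] at hp
    exact (ih (by omega)).trans (Ll_cons_ge G (by omega))

theorem s_le_Sc (G : P.Good) (p : List ℝ) (hp : p.length ≤ P.n) : P.s ≤ P.Sc p :=
  (s_le_Ll G p hp).trans (Ll_le_Sc G p)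

theorem Sc_wall_ge (G : P.Good) {v : ℝ} {p : List ℝ} (hv : v ∈ P.walls p) :
    10 * P.Sc p ≤ P.Sc (v :: p) := by
  simp only [Sc, if_pos hv]
  have := Sc_pos G p
  have hL := G.Lpos
  have := G.Lpow (P.n - (p.length + 1))
  nlinarith

noncomputable def thr (P : Par) (p : List ℝ) : ℝ :=
  10 * (P.Nb : ℝ) ^ (P.n - p.length + 2) * P.Uu p / P.L

theorem sep (G : P.Good) (p : List ℝ) (hp : p.length ≤ P.n) (hl : P.Legit p) :
    ∀ x ∈ combos (P.Nf (P.n - p.length + 1)) p, x = 0 ∨ thr P p ≤ |x| := by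
  have hL := G.Lpos
  have hLp : 0 < P.L := by linarith
  have hNb : (1 : ℝ) ≤ P.Nb := by exact_mod_cast P.Nf_pos _
  induction p with
  | nil =>
    intro x hx
    left
    simpa [combos] using hx
  | cons v p ih =>
    simp only [List.length_cons] at hp
    have hp' : p.length < P.n := by omega
    specialize ih (by omega) hl.1
    obtain ⟨h, hh⟩ : ∃ h, P.n - p.length = h + 1 := ⟨P.n - p.length - 1, by omega⟩
    have hh' : P.n - (p.length + 1) = h := by omega
    have hhn : h + 1 ≤ P.n := by omega
    simp only [List.length_cons, hh'] 
    rw [hh] at ih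
    have hUp : 0 < P.Uu p := by
      have := Sc_pos G p
      unfold Uu; positivity
    have hUle := Uu_cons_le G (v := v) hp'
    have hthr : thr P (v :: p) * P.Nb ≤ thr P p := by
      simp only [thr, List.length_cons, hh, hh']
      rw [show h + 1 + 2 = (h + 2) + 1 by ring, pow_succ (P.Nb : ℝ) (h + 2), div_mul_eq_mul_div]
      gcongr ?_ / _
      have h9 : 0 ≤ 10 * ((P.Nb : ℝ) ^ (h + 2) * P.Nb) := by positivity
      nlinarith [mul_le_mul_of_nonneg_left hUle h9]
    have hNle : P.Nf (h + 1) ≤ P.Nb := P.Nf_mono hhn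
    have hUp' : 0 < P.Uu (v :: p) := by
      have := Sc_pos G (v :: p)
      unfold Uu; positivity
    have ht0 : 0 ≤ thr P (v :: p) := by
      unfold thr; positivity
    intro x hx
    obtain ⟨a, ha, y, hy, rfl⟩ := mem_combos_cons.1 hx
    by_cases ha0 : a = 0
    · subst ha0
      rcases ih y (combos_mono (P.Nf_le_succ _) hy) with h0 | h0
      · left; simp [h0]
      · right
        simp only [Int.cast_zero, zero_mul, zero_add]
        nlinarith
    by_cases hv : v ∈ P.walls p
    · obtain ⟨c, hc1, hc, z, hz, rfl⟩ := P.mem_walls.1 hv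
      rw [hh] at hc hz
      have hcR : (1 : ℝ) ≤ c := by exact_mod_cast hc1
      have hmem : (c : ℝ) * (a * (z / c) + y) ∈ combos (P.Nf (h + 1 + 1)) p := by
        have h1 := combos_add (combos_smul ha hz) (combos_smul (m := P.Nf (h+1)) (c := (c:ℤ))
          (by simpa using hc) hy)
        rw [P.Nf_succ (h + 1)]
        convert h1 using 2
        · ring
        · push_cast; field_simp
      rcases ih _ hmem with h0 | h0
      · left
        rcases mul_eq_zero.1 h0 with h0 | h0
        · linarith
        · exact h0
      · right
        rw [abs_mul, abs_of_pos (by linarith : (0 : ℝ) < c)] at h0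
        have hcb : (c : ℝ) ≤ P.Nb := by exact_mod_cast hc.trans hNle
        have h2 : thr P (z / c :: p) * P.Nb ≤ |a * (z / c) + y| * P.Nb := by
          refine hthr.trans (h0.trans ?_)
          rw [mul_comm]
          gcongr
        exact le_of_mul_le_mul_right h2 (by linarith)
    · right
      have hA := (hl.2.2.resolve_left hv).2
      have haR : (1 : ℝ) ≤ |(a : ℝ)| := by
        have := Int.one_le_abs ha0
        exact_mod_cast this
      have hw : -y / a ∈ P.walls p := by
        refine P.mem_walls.2 ⟨a.natAbs, Int.natAbs_pos.2 ha0, ?_, ?_⟩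
        · rw [hh]; 
          have : (a.natAbs : ℤ) ≤ (P.Nf (h+1) : ℕ) := by rw [Int.natCast_natAbs]; exact ha
          exact_mod_cast this
        · rw [hh]
          rcases lt_or_gt_of_ne ha0 with hneg | hpos
          · refine ⟨y, hy, ?_⟩
            have : ((a.natAbs : ℕ) : ℝ) = -(a : ℝ) := by
              rw [Nat.cast_natAbs, abs_of_neg hneg]; push_cast; rfl
            rw [this, neg_div, div_neg]
          · refine ⟨-y, combos_neg hy, ?_⟩
            have : ((a.natAbs : ℕ) : ℝ) = (a : ℝ) := by
              rw [Nat.cast_natAbs, abs_of_pos hpos]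
            rw [this]
      have h1 := hA _ hw
      have haR' : (a : ℝ) ≠ 0 := by exact_mod_cast ha0
      have h2 : (a : ℝ) * v + y = a * (v - -y / a) := by field_simp; ring
      rw [h2, abs_mul]
      have h3 : thr P (v :: p) ≤ P.Sc p := by
        simp only [thr, List.length_cons, hh']
        rw [Uu_free G hv, div_le_iff₀ hLp]
        have hSp := Sc_pos G p
        have : 10 * (P.Nb : ℝ) ^ (h + 2) ≤ P.L := by
          refine le_trans ?_ G.L1
          gcongr
          omega
        nlinarith
      have hSp := Sc_pos G p
      nlinarith [abs_nonneg (v - -y / a)]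

theorem walls_sep (G : P.Good) {p : List ℝ} (hp : p.length ≤ P.n) (hl : P.Legit p) {w w' : ℝ}
    (hw : w ∈ P.walls p) (hw' : w' ∈ P.walls p) (hne : w ≠ w') :
    10 * P.Sc p ≤ |w - w'| := by
  have hL := G.Lpos
  have hLp : 0 < P.L := by linarith
  have hNb : (1 : ℝ) ≤ P.Nb := by exact_mod_cast P.Nf_pos _
  obtain ⟨c, hc1, hc, z, hz, rfl⟩ := P.mem_walls.1 hw
  obtain ⟨c', hc1', hc', z', hz', rfl⟩ := P.mem_walls.1 hw'
  set h := P.n - p.length with hh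
  have hcR : (1 : ℝ) ≤ c := by exact_mod_cast hc1
  have hcR' : (1 : ℝ) ≤ c' := by exact_mod_cast hc1'
  have hNle : P.Nf h ≤ P.Nb := P.Nf_mono (Nat.sub_le _ _)
  have hcb : (c : ℝ) ≤ P.Nb := by exact_mod_cast hc.trans hNle
  have hcb' : (c' : ℝ) ≤ P.Nb := by exact_mod_cast hc'.trans hNle
  have hmem : (c : ℝ) * c' * (z / c - z' / c') ∈ combos (P.Nf (h + 1)) p := by
    have h1 := combos_add (combos_smul (m := P.Nf h) (c := (c' : ℤ)) (by simpa using hc') hz)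
      (combos_smul (m := P.Nf h) (c := -(c:ℤ)) (by simpa using hc) hz')
    rw [P.Nf_succ h]
    convert h1 using 2
    · ring
    · push_cast; field_simp; ring
  have hne' : z / c - z' / c' ≠ 0 := sub_ne_zero.2 hne
  have h0 := (sep G p hp hl _ hmem).resolve_left (by positivity)
  rw [abs_mul, abs_of_pos (by positivity : (0 : ℝ) < c * c')] at h0
  have hS := Sc_pos G p
  have hU := Uu_ge G p
  have h1 : 10 * P.Sc p * (P.Nb ^ 2) ≤ thr P p := by
    unfold thr
    rw [le_div_iff₀ hLp, ← hh]
    have hx : (P.Nb : ℝ) ^ 2 ≤ (P.Nb : ℝ) ^ (h + 2) := pow_le_pow_right₀ hNb (by omega)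
    calc 10 * P.Sc p * (P.Nb ^ 2) * P.L = 10 * (P.Nb : ℝ) ^ 2 * (P.Sc p * P.L) := by ring
      _ ≤ 10 * (P.Nb : ℝ) ^ (h + 2) * P.Uu p := by gcongr
  have h2 : 10 * P.Sc p * (P.Nb ^ 2) ≤ |z / c - z' / c'| * P.Nb ^ 2 := by
    refine h1.trans (h0.trans ?_)
    rw [mul_comm, sq]
    gcongr
  exact le_of_mul_le_mul_right h2 (by positivity)

end Par
end GP

open Finset Filter

namespace GP
namespace Par
variable {P : Par}

noncomputable def al (S : ℝ) : ℝ := (S - 1) * Real.exp S + (S + 1) * Real.exp (-S)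

noncomputable def Tht (P : Par) (p : List ℝ) (v : ℝ) : ℝ :=
  (if v ∈ P.walls p then (P.Sc p + 1) * Real.exp (-P.Sc p - v) else Real.exp (-v))
  + ∑ w ∈ (P.walls p).filter (fun w => v < w), Real.exp (-w) * al (P.Sc p)

theorem al_nonneg {S : ℝ} (hS : 1 ≤ S) : 0 ≤ al S := by
  unfold al
  have h1 := Real.exp_pos S
  have h2 := Real.exp_pos (-S)
  have : 0 ≤ S - 1 := by linarith
  positivity

theorem al_le {S : ℝ} (hS : 1 ≤ S) : al S ≤ (S + 1) * Real.exp S := by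
  unfold al
  have h1 := Real.exp_pos S
  have h2 : (S + 1) * Real.exp (-S) ≤ 2 * Real.exp S := by
    have : S + 1 ≤ Real.exp S := Real.add_one_le_exp S
    have h3 : Real.exp (-S) * Real.exp S = 1 := by rw [← Real.exp_add]; simp
    have h4 : Real.exp (-S) ≤ 1 := Real.exp_le_one_iff.2 (by linarith)
    have := Real.exp_pos (-S)
    nlinarith
  linarith

theorem Tht_nonneg (G : P.Good) {p : List ℝ} (hp : p.length ≤ P.n) (v : ℝ) : 0 ≤ P.Tht p v := by
  have hS := s_le_Sc G p hp
  have hs := G.s10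
  unfold Tht
  refine add_nonneg ?_ (Finset.sum_nonneg fun w _ => mul_nonneg (Real.exp_pos _).le
    (al_nonneg (by linarith)))
  have : 0 ≤ P.Sc p + 1 := by linarith
  split_ifs <;> positivity

theorem Tht_tie (G : P.Good) {p : List ℝ} (hp : p.length ≤ P.n) (hl : P.Legit p) {v : ℝ}
    (hv : v ∈ P.walls p) :
    P.Tht p v ≤ 2 * (P.Sc p + 1) * Real.exp (-P.Sc p - v) := by
  have hS := s_le_Sc G p hp
  have hs := G.s10
  unfold Tht
  rw [if_pos hv]
  set S := P.Sc p with hSd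
  have hterm : ∀ w ∈ (P.walls p).filter (fun w => v < w),
      Real.exp (-w) * al S ≤ (S + 1) * Real.exp (-S - v) * Real.exp (-(8 * S)) := by
    intro w hw
    rw [Finset.mem_filter] at hw
    have h1 := walls_sep G hp hl hw.1 hv hw.2.ne'
    rw [abs_of_pos (by linarith [hw.2])] at h1
    have h2 : Real.exp (-w) * Real.exp S ≤ Real.exp (-S - v) * Real.exp (-(8 * S)) := by
      rw [← Real.exp_add, ← Real.exp_add]
      exact Real.exp_le_exp.2 (by linarith)
    have h3 := al_le (S := S) (by linarith)
    have h4 := Real.exp_pos (-w)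
    calc Real.exp (-w) * al S ≤ Real.exp (-w) * ((S + 1) * Real.exp S) := by gcongr
      _ = (S + 1) * (Real.exp (-w) * Real.exp S) := by ring
      _ ≤ (S + 1) * (Real.exp (-S - v) * Real.exp (-(8 * S))) := by
        have : 0 ≤ S + 1 := by linarith
        gcongr
      _ = _ := by ring
  have hsum := Finset.sum_le_card_nsmul _ _ _ hterm
  rw [nsmul_eq_mul] at hsum
  have hc : (((P.walls p).filter (fun w => v < w)).card : ℝ) ≤ (P.Nb * (2 * P.Nb + 1) ^ P.n : ℕ) := by
    exact_mod_cast (Finset.card_filter_le _ _).trans (P.card_walls p hp)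
  have hT := G.T2 S (hS)
  have hpos : 0 ≤ (S + 1) * Real.exp (-S - v) := by
    have : 0 ≤ S + 1 := by linarith
    positivity
  have h5 : (((P.walls p).filter (fun w => v < w)).card : ℝ) * Real.exp (-(8 * S)) ≤ 1 / 2 :=
    (mul_le_mul_of_nonneg_right hc (Real.exp_pos _).le).trans hT
  have h6 := mul_le_mul_of_nonneg_left h5 hpos
  nlinarith

theorem Tht_up {p : List ℝ} {w u : ℝ} (hw : w ∈ P.walls p) (hu : u ∉ P.walls p) (hwu : w < u)
    (h : ∀ w' ∈ P.walls p, w' ≤ w ∨ u < w') :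
    P.Tht p w - P.Tht p u = (P.Sc p + 1) * Real.exp (-P.Sc p - w) - Real.exp (-u) := by
  unfold Tht
  rw [if_pos hw, if_neg hu]
  have : (P.walls p).filter (fun x => w < x) = (P.walls p).filter (fun x => u < x) := by
    ext a
    simp only [Finset.mem_filter]
    refine and_congr_right fun ha => ⟨fun h1 => ?_, fun h1 => hwu.trans h1⟩
    rcases h a ha with h2 | h2
    · linarith
    · exact h2
  rw [this]; ring

theorem Tht_free {p : List ℝ} {u v : ℝ} (hu : u ∉ P.walls p) (hv : v ∉ P.walls p) (huv : u < v)
    (h : ∀ w' ∈ P.walls p, w' ≤ u ∨ v < w') :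
    P.Tht p u - P.Tht p v = Real.exp (-u) - Real.exp (-v) := by
  unfold Tht
  rw [if_neg hv, if_neg hu]
  have : (P.walls p).filter (fun x => u < x) = (P.walls p).filter (fun x => v < x) := by
    ext a
    simp only [Finset.mem_filter]
    refine and_congr_right fun ha => ⟨fun h1 => ?_, fun h1 => huv.trans h1⟩
    rcases h a ha with h2 | h2
    · linarith
    · exact h2
  rw [this]; ring

theorem Tht_down {p : List ℝ} {u w : ℝ} (hu : u ∉ P.walls p) (hw : w ∈ P.walls p) (huw : u < w)
    (h : ∀ w' ∈ P.walls p, w' ≤ u ∨ w ≤ w') :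
    P.Tht p u - P.Tht p w = Real.exp (-u) + (P.Sc p - 1) * Real.exp (P.Sc p - w) := by
  unfold Tht
  rw [if_pos hw, if_neg hu]
  have : (P.walls p).filter (fun x => u < x) = insert w ((P.walls p).filter (fun x => w < x)) := by
    ext a
    simp only [Finset.mem_filter, Finset.mem_insert]
    constructor
    · rintro ⟨ha, h1⟩
      rcases h a ha with h2 | h2
      · linarith
      · rcases h2.eq_or_lt with h3 | h3
        · exact Or.inl h3.symm
        · exact Or.inr ⟨ha, h3⟩
    · rintro (rfl | ⟨ha, h1⟩)
      · exact ⟨hw, huw⟩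
      · exact ⟨ha, huw.trans h1⟩
  rw [this, Finset.sum_insert (by simp)]
  have e1 : Real.exp (P.Sc p - w) = Real.exp (P.Sc p) * Real.exp (-w) := by
    rw [← Real.exp_add]; ring_nf
  have e2 : Real.exp (-P.Sc p - w) = Real.exp (-P.Sc p) * Real.exp (-w) := by
    rw [← Real.exp_add]; ring_nf
  rw [e1, e2]; unfold al; ring

def dot (f : ℕ → ℝ) : List ℝ → ℝ
  | [] => 0
  | v :: p => f p.length * v + dot f p

noncomputable def ThS (P : Par) : List ℝ → ℝ
  | [] => 0
  | v :: p => P.Tht p v + ThS P p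

noncomputable def cost (P : Par) (x : ℕ → ℝ) (q : List ℝ) : ℝ := dot x q + P.ThS q

theorem cost_cons (x : ℕ → ℝ) (v : ℝ) (p : List ℝ) :
    P.cost x (v :: p) = P.cost x p + x p.length * v + P.Tht p v := by
  simp only [cost, dot, ThS]; ring

theorem dec_aux {S S' : ℝ} (h0 : 0 ≤ S) (h : S ≤ S') :
    (S' + 1) * Real.exp (-S') ≤ (S + 1) * Real.exp (-S) := by
  have h1 : (S' - S) + 1 ≤ Real.exp (S' - S) := Real.add_one_le_exp _
  have h2 : Real.exp (-S) = Real.exp (-S') * Real.exp (S' - S) := by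
    rw [← Real.exp_add]; ring_nf
  rw [h2]
  have := Real.exp_pos (-S')
  have h3 : S' + 1 ≤ (S + 1) * Real.exp (S' - S) := by nlinarith
  nlinarith

noncomputable def tau1 (P : Par) (u : ℝ) (p : List ℝ) : ℝ :=
  2 * (P.Sc (u :: p) + 1) * Real.exp (-P.Sc (u :: p)) * Real.exp (-u)

theorem ties (G : P.Good) (x : ℕ → ℝ) {u : ℝ} {p : List ℝ} (hl : P.Legit (u :: p)) (m : ℕ)
    (hm : p.length + 1 + m ≤ P.n) :
    P.Legit (List.replicate m u ++ u :: p) ∧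
    P.Sc (u :: p) ≤ P.Sc (List.replicate m u ++ u :: p) ∧
    P.cost x (List.replicate m u ++ u :: p) ≤ P.cost x (u :: p)
      + u * ∑ i ∈ Finset.Ico (p.length + 1) (p.length + 1 + m), x i + m * P.tau1 u p := by
  induction m with
  | zero => simp [hl]
  | succ m ih =>
    obtain ⟨h1, h2, h3⟩ := ih (by omega)
    set q := List.replicate m u ++ u :: p with hq
    have hqh : q.headD 0 = u := by
      rw [hq]; cases m <;> simp [List.replicate_succ]
    have hql : q.length = p.length + 1 + m := by
      rw [hq]; simp; omega
    have hwall : u ∈ P.walls q := by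
      have := P.head_mem_walls q
      rwa [hqh] at this
    rw [List.replicate_succ, List.cons_append, ← hq]
    refine ⟨⟨h1, hqh.le, Or.inl hwall⟩, h2.trans ?_, ?_⟩
    · have := Sc_wall_ge G hwall
      have := Sc_pos G q
      linarith
    · rw [cost_cons, hql]
      have h4 := Tht_tie G (by omega) h1 hwall
      have h5 : P.Tht q u ≤ P.tau1 u p := by
        refine h4.trans ?_
        have e2 : Real.exp (-P.Sc q - u) = Real.exp (-P.Sc q) * Real.exp (-u) := by
          rw [← Real.exp_add]; ring_nf
        rw [e2]; unfold tau1
        have := dec_aux (Sc_pos G (u :: p)).le h2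
        have := Real.exp_pos (-u)
        nlinarith
      have h6 : ∑ i ∈ Finset.Ico (p.length + 1) (p.length + 1 + (m + 1)), x i =
          ∑ i ∈ Finset.Ico (p.length + 1) (p.length + 1 + m), x i + x (p.length + 1 + m) := by
        rw [← add_assoc, Finset.sum_Ico_succ_top (by omega)]
      rw [h6]; push_cast
      linarith

theorem lower (G : P.Good) (x : ℕ → ℝ) (hx : ∀ i < P.n, 0 ≤ x i) {v : ℝ} {p : List ℝ} (t : List ℝ)
    (hl : P.Legit (t ++ v :: p)) (hm : (t ++ v :: p).length ≤ P.n) :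
    v ≤ (t ++ v :: p).headD 0 ∧
    P.cost x (v :: p)
      + v * ∑ i ∈ Finset.Ico (p.length + 1) (p.length + 1 + t.length), x i
      ≤ P.cost x (t ++ v :: p) := by
  induction t with
  | nil => simp
  | cons a t ih =>
    rw [List.cons_append] at hl hm ⊢
    simp only [List.length_cons] at hm
    obtain ⟨h1, h2⟩ := ih hl.1 (by omega)
    have h3 := hl.2.1
    have hql : (t ++ v :: p).length = p.length + 1 + t.length := by simp; omega
    refine ⟨h1.trans h3, ?_⟩
    rw [cost_cons x a (t ++ v :: p), hql, List.length_cons, ← add_assoc, Finset.sum_Ico_succ_top (by omega)]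
    have h4 := Tht_nonneg G (p := t ++ v :: p) (by omega) a
    have h5 := hx (p.length + 1 + t.length) (by omega)
    have h6 := mul_le_mul_of_nonneg_left (h1.trans h3) h5
    linarith

theorem legit_suffix (t : List ℝ) {p : List ℝ} (h : P.Legit (t ++ p)) : P.Legit p := by
  induction t with
  | nil => exact h
  | cons a t ih => exact ih h.1

structure MinAt (P : Par) (x : ℕ → ℝ) (q : List ℝ) : Prop where
  legit : P.Legit q
  len : q.length = P.n
  pos : ∀ i < P.n, 0 < x i
  anti : ∀ i j, i ≤ j → j < P.n → x j ≤ x i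
  bd : ∀ i < P.n, x i ≤ Real.exp P.K
  min : ∀ q', P.Legit q' → q'.length = P.n → P.cost x q ≤ P.cost x q'

theorem compare (G : P.Good) {x : ℕ → ℝ} {t p : List ℝ} {v u : ℝ}
    (hM : P.MinAt x (t ++ v :: p)) (hu : P.Adm p u) :
    ∃ R, 0 ≤ R ∧ R ≤ (P.n - 1) * x p.length ∧
    v * x p.length + P.Tht p v + v * R ≤ u * x p.length + P.Tht p u + u * R + P.n * P.tau1 u p := by
  have hlen := hM.len
  have hlen' : p.length + 1 + t.length = P.n := by rw [← hlen]; simp; omega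
  have hk : p.length < P.n := by omega
  have hlu : P.Legit (u :: p) := ⟨(legit_suffix t hM.legit).1, hu⟩
  obtain ⟨h1, h2, h3⟩ := ties G x hlu t.length (by omega)
  obtain ⟨h4, h5⟩ := lower G x (fun i hi => (hM.pos i hi).le) t hM.legit (by omega)
  have h6 := hM.min _ h1 (by simp; omega)
  refine ⟨∑ i ∈ Finset.Ico (p.length + 1) (p.length + 1 + t.length), x i,
    Finset.sum_nonneg fun i hi => ?_, ?_, ?_⟩
  · rw [Finset.mem_Ico] at hi; exact (hM.pos i (by omega)).le
  · have := Finset.sum_le_card_nsmul (Finset.Ico (p.length + 1) (p.length + 1 + t.length)) x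
      (x p.length) (fun i hi => by rw [Finset.mem_Ico] at hi; exact hM.anti _ _ (by omega) (by omega))
    refine this.trans ?_
    rw [nsmul_eq_mul]
    refine mul_le_mul_of_nonneg_right ?_ (hM.pos _ hk).le
    simp only [Nat.card_Ico]
    have : ((p.length + 1 + t.length : ℕ) : ℝ) = P.n := by exact_mod_cast hlen'
    push_cast at this
    rw [Nat.add_sub_cancel_left]
    have : (0 : ℝ) ≤ p.length := by positivity
    linarith
  · rw [cost_cons] at h3 h5
    have h7 : (t.length : ℝ) * P.tau1 u p ≤ P.n * P.tau1 u p := by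
      have : 0 ≤ P.tau1 u p := by
        unfold tau1
        have := Sc_pos G (u :: p)
        positivity
      have : (t.length : ℝ) ≤ P.n := by exact_mod_cast (by omega)
      gcongr
    linarith

theorem cmpD (G : P.Good) {x : ℕ → ℝ} {t p : List ℝ} {v u : ℝ}
    (hM : P.MinAt x (t ++ v :: p)) (hu : P.Adm p u) (huv : u ≤ v) :
    (v - u) * x p.length ≤ P.Tht p u - P.Tht p v + P.n * P.tau1 u p := by
  obtain ⟨R, h0, h1, h2⟩ := compare G hM hu
  nlinarith [mul_le_mul_of_nonneg_right huv h0]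

theorem cmpU (G : P.Good) {x : ℕ → ℝ} {t p : List ℝ} {v u : ℝ}
    (hM : P.MinAt x (t ++ v :: p)) (hu : P.Adm p u) (huv : v ≤ u) :
    P.Tht p v - P.Tht p u ≤ (u - v) * (P.n * x p.length) + P.n * P.tau1 u p := by
  obtain ⟨R, h0, h1, h2⟩ := compare G hM hu
  nlinarith [mul_le_mul_of_nonneg_left h1 (sub_nonneg.2 huv)]

theorem tau_gen (G : P.Good) {p : List ℝ} (hp : p.length < P.n) (u : ℝ) :
    P.n * P.tau1 u p ≤ 1 / 10 * Real.exp (-u) := by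
  have h := G.T1 (P.Sc (u :: p)) (s_le_Sc G _ (by simpa using hp))
  unfold tau1
  have := mul_le_mul_of_nonneg_right h (Real.exp_pos (-u)).le
  linarith

theorem tau_wall (G : P.Good) {p : List ℝ} (hp : p.length < P.n) {u : ℝ} (hu : u ∈ P.walls p) :
    P.n * P.tau1 u p ≤ 2 / 10 * Real.exp (-P.Sc p - u) := by
  have hS := Sc_pos G p
  have h10 := Sc_wall_ge G hu
  have hsS := s_le_Sc G p hp.le
  have hs := G.s10
  set S1 := P.Sc (u :: p) with hS1
  have h := G.T1 (S1 / 2) (by linarith)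
  unfold tau1
  rw [← hS1]
  have e : Real.exp (-S1) = Real.exp (-(S1 / 2)) * Real.exp (-(S1 / 2)) := by
    rw [← Real.exp_add]; ring_nf
  have h1 : Real.exp (-(S1/2)) * Real.exp (-u) ≤ Real.exp (-P.Sc p - u) := by
    rw [← Real.exp_add]; exact Real.exp_le_exp.2 (by linarith)
  have h2 : 2 * P.n * (S1 + 1) * Real.exp (-(S1 / 2)) ≤ 2 / 10 := by
    have : 0 ≤ 2 * (P.n : ℝ) * Real.exp (-(S1 / 2)) := by positivity
    nlinarith
  calc P.n * (2 * (S1 + 1) * Real.exp (-S1) * Real.exp (-u))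
      = (2 * P.n * (S1 + 1) * Real.exp (-(S1 / 2))) * (Real.exp (-(S1/2)) * Real.exp (-u)) := by
        rw [e]; ring
    _ ≤ 2 / 10 * Real.exp (-P.Sc p - u) := by
        have := Real.exp_pos (-(S1/2)); have := Real.exp_pos (-u)
        gcongr

end Par
end GP

open Finset Filter

namespace GP
namespace Par
variable {P : Par}

theorem far_of_wall (G : P.Good) {p : List ℝ} (hp : p.length ≤ P.n) (hl : P.Legit p) {w u : ℝ}
    (hw : w ∈ P.walls p) (h1 : P.Sc p ≤ |u - w|) (h2 : |u - w| ≤ P.Sc p + 1) :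
    ∀ w' ∈ P.walls p, P.Sc p ≤ |u - w'| := by
  intro w' hw'
  by_cases h : w = w'
  · rw [← h]; exact h1
  · have h3 := walls_sep G hp hl hw hw' h
    have hs := s_le_Sc G p hp
    have := G.s10
    have h4 := abs_sub_le w u w'
    rw [abs_sub_comm w u] at h4
    linarith

theorem notwall_of_far (G : P.Good) {p : List ℝ} {u : ℝ}
    (h : ∀ w' ∈ P.walls p, P.Sc p ≤ |u - w'|) : u ∉ P.walls p := by
  intro hu
  have := h u hu
  have := Sc_pos G p
  simp at *; linarith

/-- only one wall near -/
theorem other_walls (G : P.Good) {p : List ℝ} (hp : p.length ≤ P.n) (hl : P.Legit p) {w w' : ℝ}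
    (hw : w ∈ P.walls p) (hw' : w' ∈ P.walls p) :
    w' = w ∨ w' ≤ w - 10 * P.Sc p ∨ w + 10 * P.Sc p ≤ w' := by
  by_cases h : w = w'
  · exact Or.inl h.symm
  · right
    have h3 := walls_sep G hp hl hw hw' h
    rcases le_abs.1 h3 with h4 | h4
    · left; linarith
    · right; linarith

section
variable {x : ℕ → ℝ} {t p : List ℝ} {v : ℝ}

theorem wall_lo (G : P.Good) (hM : P.MinAt x (t ++ v :: p)) (hv : v ∈ P.walls p) :
    Real.exp (-P.Sc p - v) ≤ 3 * P.n * x p.length := by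
  have hlen := hM.len
  have hk : p.length < P.n := by rw [← hlen]; simp; omega
  have hl := legit_suffix t hM.legit
  have hs := s_le_Sc G p hk.le
  have h10 := G.s10
  set S := P.Sc p with hS
  set u : ℝ := ((⌈v + S⌉ : ℤ) : ℝ) with hu
  have hu1 : v + S ≤ u := Int.le_ceil _
  have hu2 : u < v + S + 1 := Int.ceil_lt_add_one _
  have habs : |u - v| = u - v := abs_of_pos (by linarith)
  have hfar := far_of_wall G hk.le hl.1 (u := u) hv (by rw [habs]; linarith) (by rw [habs]; linarith)
  have hun := notwall_of_far G hfar
  have hadm : P.Adm p u := ⟨by linarith [hl.2.1], Or.inr ⟨⟨_, hu⟩, hfar⟩⟩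
  have hc := cmpU G hM hadm (by linarith)
  rw [Tht_up hv hun (by linarith) (fun w' hw' => by
    rcases other_walls G hk.le hl.1 hv hw' with h | h | h
    · left; linarith
    · left; linarith
    · right; linarith)] at hc
  have ht := tau_gen G hk u
  have he : Real.exp (-u) ≤ Real.exp (-S - v) := Real.exp_le_exp.2 (by linarith)
  have hx := hM.pos _ hk
  have hnx : 0 ≤ P.n * x p.length := by positivity
  have hE := Real.exp_pos (-S - v)
  have h1 : (u - v) * (P.n * x p.length) ≤ (S + 1) * (P.n * x p.length) := by
    gcongr; linarith
  have h2 : (S - 1/10) * Real.exp (-S - v) ≤ (S + 1) * (P.n * x p.length) := by linarith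
  by_contra hcon
  push Not at hcon
  nlinarith

theorem wall_hi (G : P.Good) (hM : P.MinAt x (t ++ v :: p)) (hv : v ∈ P.walls p)
    (hnt : p.headD 0 < v) :
    x p.length ≤ 6 * Real.exp (P.Sc p - v) := by
  have hlen := hM.len
  have hk : p.length < P.n := by rw [← hlen]; simp; omega
  have hl := legit_suffix t hM.legit
  have hs := s_le_Sc G p hk.le
  have h10 := G.s10
  set S := P.Sc p with hS
  set u : ℝ := ((⌊v - S⌋ : ℤ) : ℝ) with hu
  have hu1 : u ≤ v - S := Int.floor_le _
  have hu2 : v - S - 1 < u := Int.sub_one_lt_floor _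
  have habs : |u - v| = v - u := by rw [abs_of_neg (by linarith)]; ring
  have hfar := far_of_wall G hk.le hl.1 (u := u) hv (by rw [habs]; linarith) (by rw [habs]; linarith)
  have hun := notwall_of_far G hfar
  have hhead : p.headD 0 ≤ u := by
    rcases other_walls G hk.le hl.1 hv (P.head_mem_walls p) with h | h | h <;> linarith
  have hadm : P.Adm p u := ⟨hhead, Or.inr ⟨⟨_, hu⟩, hfar⟩⟩
  have hc := cmpD G hM hadm (by linarith)
  rw [Tht_down hun hv (by linarith) (fun w' hw' => by
    rcases other_walls G hk.le hl.1 hv hw' with h | h | h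
    · right; linarith
    · left; linarith
    · right; linarith)] at hc
  have ht := tau_gen G hk u
  have he : Real.exp (-u) ≤ Real.exp 1 * Real.exp (S - v) := by
    rw [← Real.exp_add]; exact Real.exp_le_exp.2 (by linarith)
  have he1 := Real.exp_one_lt_d9
  have hx := hM.pos _ hk
  have hE := Real.exp_pos (S - v)
  have h1 : S * x p.length ≤ (v - u) * x p.length := by gcongr; linarith
  rw [← hS] at hc
  have h2 : S * x p.length ≤ (S + 2) * Real.exp (S - v) := by nlinarith
  by_contra hcon
  push Not at hcon
  nlinarith

theorem free_hi (G : P.Good) (hM : P.MinAt x (t ++ v :: p)) (hv : v ∉ P.walls p) :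
    x p.length ≤ 6 * Real.exp (- v) := by
  have hlen := hM.len
  have hk : p.length < P.n := by rw [← hlen]; simp; omega
  have hl := legit_suffix t hM.legit
  have hs := s_le_Sc G p hk.le
  have h10 := G.s10
  obtain ⟨⟨z, hz⟩, hfv⟩ := hl.2.2.resolve_left hv
  have hx := hM.pos _ hk
  have hE := Real.exp_pos (- v)
  have he1 := Real.exp_one_lt_d9
  set S := P.Sc p with hS
  have hhv : p.headD 0 + S ≤ v := by
    have h1 := hfv _ (P.head_mem_walls p)
    rw [abs_of_nonneg (by linarith [hl.2.1])] at h1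
    linarith
  by_cases hfar : ∀ w' ∈ P.walls p, S ≤ |v - 1 - w'|
  · have hun := notwall_of_far G hfar
    have hadm : P.Adm p (v - 1) := ⟨by linarith, Or.inr ⟨⟨z - 1, by rw [hz]; push_cast; ring⟩, hfar⟩⟩
    have hc := cmpD G hM hadm (by linarith)
    rw [Tht_free hun hv (by linarith) (fun w' hw' => by
      have h1 := hfar _ hw'
      have h2 := hfv _ hw'
      by_contra hcon
      push Not at hcon
      rw [abs_of_nonpos (by linarith)] at h1
      rw [abs_of_nonneg (by linarith)] at h2
      linarith)] at hc
    have ht := tau_gen G hk (v - 1)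
    have he : Real.exp (-(v - 1)) = Real.exp 1 * Real.exp (- v) := by
      rw [← Real.exp_add]; ring_nf
    rw [he] at hc ht
    nlinarith
  · push Not at hfar
    obtain ⟨w, hw, hwv⟩ := hfar
    have h2 := hfv _ hw
    rw [abs_lt] at hwv
    have hvw : S ≤ v - w := by
      rcases le_abs.1 h2 with h | h <;> linarith
    have hwh : p.headD 0 ≤ w := by
      rcases other_walls G hk.le hl.1 hw (P.head_mem_walls p) with h | h | h <;> linarith
    have hadm : P.Adm p w := ⟨hwh, Or.inl hw⟩
    have hc := cmpD G hM hadm (by linarith)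
    rw [Tht_up hw hv (by linarith) (fun w' hw' => by
      rcases other_walls G hk.le hl.1 hw hw' with h | h | h
      · left; linarith
      · left; linarith
      · right; linarith)] at hc
    have ht := tau_wall G hk hw
    rw [← hS] at ht hc
    have he : Real.exp (-S - w) ≤ Real.exp 1 * Real.exp (- v) := by
      rw [← Real.exp_add]; exact Real.exp_le_exp.2 (by linarith)
    have h1 : S * x p.length ≤ (v - w) * x p.length := by gcongr
    have he3 : Real.exp (-S - w) ≤ 3 * Real.exp (- v) := he.trans (by nlinarith)
    have h4 : (S + 2) * Real.exp (-S - w) ≤ (S + 2) * (3 * Real.exp (- v)) := by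
      have : 0 ≤ S + 2 := by linarith
      gcongr
    have h5 := Real.exp_pos (-S - w)
    have h3 : S * x p.length ≤ (S + 2) * (3 * Real.exp (- v)) := by linarith
    by_contra hcon
    push Not at hcon
    nlinarith

theorem free_lo (G : P.Good) (hM : P.MinAt x (t ++ v :: p)) (hv : v ∉ P.walls p) :
    Real.exp (- v) ≤ 5 * P.n * x p.length := by
  have hlen := hM.len
  have hk : p.length < P.n := by rw [← hlen]; simp; omega
  have hl := legit_suffix t hM.legit
  have hs := s_le_Sc G p hk.le
  have h10 := G.s10
  obtain ⟨⟨z, hz⟩, hfv⟩ := hl.2.2.resolve_left hv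
  have hx := hM.pos _ hk
  have hnx : 0 ≤ P.n * x p.length := by positivity
  have hE := Real.exp_pos (- v)
  have he1 := Real.exp_one_lt_d9
  have he2 := Real.exp_one_gt_d9
  set S := P.Sc p with hS
  by_cases hfar : ∀ w' ∈ P.walls p, S ≤ |v + 1 - w'|
  · have hun := notwall_of_far G hfar
    have hadm : P.Adm p (v + 1) := ⟨by linarith [hl.2.1],
      Or.inr ⟨⟨z + 1, by rw [hz]; push_cast; ring⟩, hfar⟩⟩
    have hc := cmpU G hM hadm (by linarith)
    rw [Tht_free hv hun (by linarith) (fun w' hw' => by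
      have h1 := hfar _ hw'
      have h2 := hfv _ hw'
      by_contra hcon
      push Not at hcon
      rw [abs_of_nonneg (by linarith)] at h1
      rw [abs_of_nonpos (by linarith)] at h2
      linarith)] at hc
    have ht := tau_gen G hk (v + 1)
    have he : Real.exp (-v) = Real.exp 1 * Real.exp (-(v + 1)) := by
      rw [← Real.exp_add]; ring_nf
    have hE' := Real.exp_pos (-(v + 1))
    nlinarith
  · push Not at hfar
    obtain ⟨w, hw, hwv⟩ := hfar
    have h2 := hfv _ hw
    rw [abs_lt] at hwv
    have hvw : S ≤ w - v := by
      rcases le_abs.1 h2 with h | h <;> linarith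
    have hadm : P.Adm p w := ⟨by linarith [hl.2.1], Or.inl hw⟩
    have hc := cmpU G hM hadm (by linarith)
    rw [Tht_down hv hw (by linarith) (fun w' hw' => by
      rcases other_walls G hk.le hl.1 hw hw' with h | h | h
      · right; linarith
      · left; linarith
      · right; linarith)] at hc
    have ht := tau_wall G hk hw
    rw [← hS] at ht hc
    have he : Real.exp (-v) ≤ Real.exp 1 * Real.exp (S - w) := by
      rw [← Real.exp_add]; exact Real.exp_le_exp.2 (by linarith)
    have he' : Real.exp (-S - w) ≤ Real.exp (-v) := Real.exp_le_exp.2 (by linarith)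
    have hE' := Real.exp_pos (S - w)
    have h1 : (w - v) * (P.n * x p.length) ≤ (S + 1) * (P.n * x p.length) := by
      gcongr; linarith
    have h3 : (S - 1) * Real.exp (S - w) ≤ (S + 1) * (P.n * x p.length) := by linarith
    by_contra hcon
    push Not at hcon
    have h4 : Real.exp (-v) ≤ 3 * Real.exp (S - w) := by nlinarith
    nlinarith

theorem log_lo (G : P.Good) {a b c : ℝ} (ha : 0 < a) (hc : 0 < c) (hc' : c ≤ 20 * P.n)
    (h : Real.exp b ≤ c * a) : -Real.log a ≤ -b + P.c1 := by
  have h1 : Real.exp b ≤ Real.exp P.c1 * a := h.trans (by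
    have := G.c1e
    gcongr; linarith)
  have h2 := Real.log_le_log (Real.exp_pos _) h1
  rw [Real.log_mul (Real.exp_pos _).ne' ha.ne', Real.log_exp, Real.log_exp] at h2
  linarith

theorem log_hi (G : P.Good) {a b : ℝ} (ha : 0 < a)
    (h : a ≤ 6 * Real.exp b) : -b - P.c1 ≤ -Real.log a := by
  have hn : (1 : ℝ) ≤ P.n := by exact_mod_cast P.hn
  have h1 : a ≤ Real.exp P.c1 * Real.exp b := h.trans (by
    have := G.c1e
    gcongr; linarith)
  rw [← Real.exp_add] at h1
  have h2 := Real.log_le_log ha h1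
  rw [Real.log_exp] at h2
  linarith

theorem Good.c1pos (G : P.Good) : 0 ≤ P.c1 := by
  have := G.c1e
  have hn : (1 : ℝ) ≤ P.n := by exact_mod_cast P.hn
  have h : (1 : ℝ) ≤ Real.exp P.c1 := by linarith
  exact Real.one_le_exp_iff.1 h

theorem free_err (G : P.Good) (hM : P.MinAt x (t ++ v :: p)) (hv : v ∉ P.walls p) :
    |-Real.log (x p.length) - v| ≤ P.c1 := by
  have hk : p.length < P.n := by rw [← hM.len]; simp; omega
  have hx := hM.pos _ hk
  have hn : (1 : ℝ) ≤ P.n := by exact_mod_cast P.hn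
  have h1 := log_lo G hx (c := 5 * P.n) (by positivity) (by linarith) (free_lo G hM hv)
  have h2 := log_hi G hx (free_hi G hM hv)
  rw [abs_le]; constructor <;> linarith

theorem wall_err_lo (G : P.Good) (hM : P.MinAt x (t ++ v :: p)) (hv : v ∈ P.walls p) :
    -Real.log (x p.length) - v ≤ P.Sc p + P.c1 := by
  have hk : p.length < P.n := by rw [← hM.len]; simp; omega
  have hx := hM.pos _ hk
  have hn : (1 : ℝ) ≤ P.n := by exact_mod_cast P.hn
  have h1 := log_lo G hx (c := 3 * P.n) (by positivity) (by linarith) (wall_lo G hM hv)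
  linarith

theorem wall_err_hi (G : P.Good) (hM : P.MinAt x (t ++ v :: p)) (hv : v ∈ P.walls p)
    (hnt : p.headD 0 < v) :
    -(P.Sc p + P.c1) ≤ -Real.log (x p.length) - v := by
  have hk : p.length < P.n := by rw [← hM.len]; simp; omega
  have hx := hM.pos _ hk
  have h1 := log_hi G hx (wall_hi G hM hv hnt)
  linarith

end

theorem acc (G : P.Good) {x : ℕ → ℝ} (p : List ℝ) : ∀ t, P.MinAt x (t ++ p) →
    (∀ v p0, p = v :: p0 → |-Real.log (x p0.length) - v| ≤ P.Ll p + P.c1) ∧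
    (∀ v p0, p = v :: p0 → v ∈ P.walls p0 → |-Real.log (x p0.length) - v| ≤ P.Sc p0 + P.c1) ∧
    (∀ d : ℕ → ℝ, (∀ i, |d i| ≤ P.N0) →
      |∑ i ∈ Finset.range p.length, d i * (-Real.log (x i)) - dot d p| ≤
        p.length * P.N0 * (P.Ll p + P.c1)) := by
  have hc1 := G.c1pos
  induction p with
  | nil =>
    intro t hM
    simp [dot]
  | cons v p ih =>
    intro t hM
    obtain ⟨ih1, -, ih3⟩ := ih (t ++ [v]) (by simpa using hM)
    have hk : p.length < P.n := by rw [← hM.len]; simp; omega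
    have hl := legit_suffix t hM.legit
    have hmonoL := Ll_cons_ge G (v := v) hk
    have hLp := s_le_Ll G p hk.le
    have h10 := G.s10
    have hsS := s_le_Sc G p hk.le
    have hw : v ∈ P.walls p → |-Real.log (x p.length) - v| ≤ P.Sc p + P.c1 := by
      intro hv
      rw [abs_le]
      refine ⟨?_, wall_err_lo G hM hv⟩
      rcases hl.2.1.lt_or_eq with hlt | heq
      · exact wall_err_hi G hM hv hlt
      · cases p with
        | nil =>
          simp only [List.headD_nil] at heq
          have h1 := hM.bd 0 hk
          have h2 := Real.log_le_log (hM.pos 0 hk) h1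
          rw [Real.log_exp] at h2
          have := G.hK
          simp only [List.length_nil] at *
          linarith
        | cons v0 p0 =>
          simp only [List.headD_cons] at heq
          have h1 := ih1 v0 p0 rfl
          rw [abs_le] at h1
          have h2 := hM.anti p0.length (v0 :: p0).length (by simp) hk
          have h3 := Real.log_le_log (hM.pos _ hk) h2
          have h4 := Ll_le_Sc G (v0 :: p0)
          linarith [h1.1]
    have hE : |-Real.log (x p.length) - v| ≤ P.Ll (v :: p) + P.c1 := by
      by_cases hv : v ∈ P.walls p
      · rw [Ll_wall G hv]; exact hw hv
      · have := free_err G hM hv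
        linarith
    refine ⟨?_, ?_, ?_⟩
    · rintro v' p' ⟨⟩; exact hE
    · rintro v' p' ⟨⟩; exact hw
    · intro d hd
      have h3 := ih3 d hd
      rw [List.length_cons, Finset.sum_range_succ]
      simp only [dot]
      have e : ∑ i ∈ Finset.range p.length, d i * (-Real.log (x i)) +
          d p.length * (-Real.log (x p.length)) - (d p.length * v + dot d p) =
          (∑ i ∈ Finset.range p.length, d i * (-Real.log (x i)) - dot d p) +
          d p.length * (-Real.log (x p.length) - v) := by ring
      rw [e]
      refine (abs_add_le _ _).trans ?_
      rw [abs_mul]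
      have h4 : |d p.length| * |-Real.log (x p.length) - v| ≤ P.N0 * (P.Ll (v :: p) + P.c1) :=
        mul_le_mul (hd _) hE (abs_nonneg _) (by positivity)
      have h5 : (p.length : ℝ) * P.N0 * (P.Ll p + P.c1) ≤ p.length * P.N0 * (P.Ll (v :: p) + P.c1) := by
        gcongr
      push_cast
      linarith

theorem dot_mem_combos {M : ℕ} {d : ℕ → ℤ} (hd : ∀ i, |d i| ≤ M) (p : List ℝ) :
    dot (fun i => (d i : ℝ)) p ∈ combos M p := by
  induction p with
  | nil => simp [dot, combos]
  | cons v p ih => exact mem_combos_cons.2 ⟨d p.length, hd _, _, ih, rfl⟩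

theorem consist (G : P.Good) {x : ℕ → ℝ} {d : ℕ → ℤ} (hd : ∀ i, |d i| ≤ P.N0) (p : List ℝ) :
    ∀ t, P.MinAt x (t ++ p) → 0 < dot (fun i => (d i : ℝ)) p →
    P.s / 4 ≤ ∑ i ∈ Finset.range p.length, (d i : ℝ) * (-Real.log (x i)) := by
  induction p with
  | nil => intro t _ h; simp [dot] at h
  | cons v p ih =>
    intro t hM hpos
    have hM' : P.MinAt x ((t ++ [v]) ++ p) := by simpa using hM
    by_cases h0 : d p.length = 0
    · rw [List.length_cons, Finset.sum_range_succ, h0]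
      simp only [dot, h0] at hpos
      simp only [Int.cast_zero, zero_mul, add_zero]
      exact ih _ hM' (by simpa using hpos)
    have hk : p.length < P.n := by rw [← hM.len]; simp; omega
    have hl := legit_suffix t hM.legit
    have hsS := s_le_Sc G p hk.le
    have h10 := G.s10
    have hL10 := G.Lpos
    have hc1 := G.c1pos
    obtain ⟨-, hE, -⟩ := acc G (v :: p) t hM
    specialize hE v p rfl
    obtain ⟨-, -, hacc⟩ := acc G p _ hM'
    specialize hacc (fun i => (d i : ℝ)) (fun i => by exact_mod_cast hd i)
    set D := dot (fun i => (d i : ℝ)) p with hD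
    set a := d p.length with ha
    have haR : (a : ℝ) ≠ 0 := by exact_mod_cast h0
    have ha1 : (1 : ℝ) ≤ |(a : ℝ)| := by
      have := Int.one_le_abs h0
      exact_mod_cast this
    have hN : P.N0 ≤ P.Nf (P.n - p.length) := P.N0_le _
    have hDm : D ∈ combos (P.Nf (P.n - p.length)) p :=
      combos_mono hN (dot_mem_combos hd p)
    have hw : -D / a ∈ P.walls p := by
      refine P.mem_walls.2 ⟨a.natAbs, Int.natAbs_pos.2 h0, ?_, ?_⟩
      · have : (a.natAbs : ℤ) ≤ (P.N0 : ℕ) := by rw [Int.natCast_natAbs]; exact hd _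
        have : a.natAbs ≤ P.N0 := by exact_mod_cast this
        omega
      · rcases lt_or_gt_of_ne h0 with hneg | hpos
        · refine ⟨D, hDm, ?_⟩
          have : ((a.natAbs : ℕ) : ℝ) = -(a : ℝ) := by
            rw [Nat.cast_natAbs, abs_of_neg hneg]; push_cast; rfl
          rw [this, neg_div, div_neg]
        · refine ⟨-D, combos_neg hDm, ?_⟩
          have : ((a.natAbs : ℕ) : ℝ) = (a : ℝ) := by
            rw [Nat.cast_natAbs, abs_of_pos hpos]
          rw [this]
    set w := -D / a with hwd
    have hDw : D = -(a * w) := by rw [hwd]; field_simp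
    simp only [dot] at hpos
    rw [← hD, hDw] at hpos
    have hpos' : 0 < (a : ℝ) * (v - w) := by linarith
    set S := P.Sc p with hS
    set Z := -Real.log (x p.length) with hZ
    -- main: a (Z - w) ≥ S/2
    have hn : (1 : ℝ) ≤ P.n := by exact_mod_cast P.hn
    have hN0 : (1 : ℝ) ≤ P.N0 := by exact_mod_cast P.hN0
    have hnN : (1 : ℝ) ≤ P.n * P.N0 := by nlinarith
    have hc1S : 32 * P.c1 ≤ S := by
      have := G.c1s
      nlinarith
    have hb : ∃ e f : ℝ, |Z - v| ≤ e ∧ f ≤ |v - w| ∧ S / 2 ≤ f - e := by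
      by_cases hv : v ∈ P.walls p
      · refine ⟨S + P.c1, 10 * S, hE hv, walls_sep G hk.le hl.1 hv hw ?_, by linarith⟩
        intro h
        rw [h] at hpos'; simp at hpos'
      · exact ⟨P.c1, S, free_err G hM hv, (hl.2.2.resolve_left hv).2 _ hw, by linarith⟩
    obtain ⟨e, f, he, hf, hef⟩ := hb
    have hmain : S / 2 ≤ a * (Z - w) := by
      have h1 : (a : ℝ) * (v - w) = |(a : ℝ)| * |v - w| := by
        rw [← abs_mul, abs_of_pos hpos']
      have h2 : -(|(a : ℝ)| * |Z - v|) ≤ a * (Z - v) := by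
        rw [← abs_mul]; exact neg_abs_le _
      have h3 : (a : ℝ) * (Z - w) = a * (v - w) + a * (Z - v) := by ring
      have h4 : |(a : ℝ)| * (S / 2) ≤ |(a : ℝ)| * (|v - w| - |Z - v|) := by
        gcongr; linarith
      nlinarith
    have herr : (p.length : ℝ) * P.N0 * (P.Ll p + P.c1) ≤ S / 16 := by
      have h1 := Ll_le G p
      have h2 : (p.length : ℝ) ≤ P.n := by exact_mod_cast hk.le
      have h3 : (P.n : ℝ) * P.N0 * (S / P.L) ≤ S / 32 := by
        rw [← mul_div_assoc, div_le_iff₀ (by linarith)]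
        have := G.L2
        have hS0 : 0 ≤ S := by linarith
        nlinarith
      have h4 : (P.n : ℝ) * P.N0 * P.c1 ≤ S / 32 := by
        have := G.c1s
        linarith
      have h5 : 0 ≤ P.Ll p + P.c1 := by
        have := s_le_Ll G p hk.le
        linarith
      calc (p.length : ℝ) * P.N0 * (P.Ll p + P.c1) ≤ P.n * P.N0 * (P.Ll p + P.c1) := by gcongr
        _ ≤ P.n * P.N0 * (S / P.L + P.c1) := by gcongr
        _ ≤ S / 16 := by linarith
    rw [List.length_cons, Finset.sum_range_succ]
    have h6 := neg_abs_le (∑ i ∈ Finset.range p.length, (d i : ℝ) * (-Real.log (x i)) - D)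
    rw [← ha, ← hZ]
    linarith

end Par
end GP

open Finset Filter

namespace GP

def fx {m : ℕ} (f : Fin m → ℝ) (i : ℕ) : ℝ := if h : i < m then f ⟨i, h⟩ else 0

theorem fx_fin {m : ℕ} (f : Fin m → ℝ) (i : Fin m) : fx f i = f i := by
  simp [fx]

theorem fx_lt {m : ℕ} (f : Fin m → ℝ) {i : ℕ} (h : i < m) : fx f i = f ⟨i, h⟩ := dif_pos h

def ent : List ℝ → ℕ → ℝ
  | [], _ => 0
  | v :: p, i => if i = p.length then v else ent p i

namespace Par
variable {P : Par}

theorem dot_eq (f : ℕ → ℝ) (q : List ℝ) :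
    dot f q = ∑ i ∈ Finset.range q.length, f i * ent q i := by
  induction q with
  | nil => simp [dot]
  | cons v p ih =>
    rw [List.length_cons, Finset.sum_range_succ]
    simp only [dot, ent, if_true]
    rw [ih, add_comm]
    congr 1
    refine Finset.sum_congr rfl fun i hi => ?_
    rw [Finset.mem_range] at hi
    rw [if_neg hi.ne]

theorem dot_perm (Y : Fin P.n → ℝ) (σ : Equiv.Perm (Fin P.n)) {q : List ℝ} (hq : q.length = P.n) :
    dot (fx (Y ∘ σ)) q = ∑ j, Y j * ent q (σ.symm j) := by
  rw [dot_eq, hq, Finset.sum_range, ← Equiv.sum_comp σ (fun j => Y j * ent q (σ.symm j))]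
  refine Finset.sum_congr rfl fun i _ => ?_
  rw [fx_fin]; simp

theorem ent_head {q : List ℝ} (hl : P.Legit q) :
    0 ≤ q.headD 0 ∧ (∀ i, i < q.length → 0 ≤ ent q i ∧ ent q i ≤ q.headD 0) ∧
    ∀ i j, i ≤ j → j < q.length → ent q i ≤ ent q j := by
  induction q with
  | nil => simp
  | cons v p ih =>
    obtain ⟨h0, h1, h2⟩ := ih hl.1
    have h3 := hl.2.1
    simp only [List.headD_cons, List.length_cons, ent]
    refine ⟨h0.trans h3, ?_, ?_⟩
    · intro i hi
      split_ifs with h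
      · exact ⟨h0.trans h3, le_rfl⟩
      · obtain ⟨a, b⟩ := h1 i (by omega)
        exact ⟨a, b.trans h3⟩
    · intro i j hij hj
      split_ifs with ha hb hb
      · exact le_rfl
      · omega
      · exact (h1 i (by omega)).2.trans h3
      · exact h2 i j hij (by omega)

noncomputable def phi (P : Par) (Y : Fin P.n → ℝ) (σ : Equiv.Perm (Fin P.n)) (q : List ℝ) : ℝ :=
  P.cost (fx (Y ∘ σ)) q

theorem phi_eq (Y : Fin P.n → ℝ) (σ : Equiv.Perm (Fin P.n)) {q : List ℝ} (hq : q.length = P.n) :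
    P.phi Y σ q = ∑ j, Y j * ent q (σ.symm j) + P.ThS q := by
  rw [phi, cost, dot_perm Y σ hq]

theorem core (G : P.Good) {Y : Fin P.n → ℝ} (hpos : ∀ j, 0 < Y j) (hbd : ∀ j, Y j ≤ Real.exp P.K)
    {σ : Equiv.Perm (Fin P.n)} {q : List ℝ} (hl : P.Legit q) (hlen : q.length = P.n)
    (hmin : ∀ σ' q', P.Legit q' → q'.length = P.n → P.phi Y σ q ≤ P.phi Y σ' q')
    {d : Fin P.n → ℤ} (hd : ∀ j, |d j| ≤ P.N0)
    (hdpos : 0 < ∑ j, (d j : ℝ) * ent q (σ.symm j)) :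
    P.s / 4 ≤ ∑ j, (d j : ℝ) * (-Real.log (Y j)) := by
  set ξ : Fin P.n → ℝ := fun j => ent q (σ.symm j) with hξ
  have hswap : ∀ a b, ξ a < ξ b → Y b ≤ Y a := by
    intro a b hab
    by_contra hcon
    push Not at hcon
    have h := hmin (Equiv.swap a b * σ) q hl hlen
    rw [phi_eq _ _ hlen, phi_eq _ _ hlen] at h
    have hne : a ≠ b := by rintro rfl; exact lt_irrefl _ hab
    have h1 : ∑ j, Y j * ent q ((Equiv.swap a b * σ).symm j) = ∑ j, Y j * ξ (Equiv.swap a b j) := by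
      refine Finset.sum_congr rfl fun j _ => ?_
      rfl
    have h2 : ∑ j, Y j * ent q (σ.symm j) = ∑ j, Y j * ξ j := rfl
    rw [h1, h2] at h
    have h3 : ∑ j, Y j * (ξ (Equiv.swap a b j) - ξ j) = (Y a - Y b) * (ξ b - ξ a) := by
      rw [← Finset.sum_subset (Finset.subset_univ {a, b}), Finset.sum_pair hne]
      · simp only [Equiv.swap_apply_left, Equiv.swap_apply_right]; ring
      · intro j _ hj
        simp only [Finset.mem_insert, Finset.mem_singleton, not_or] at hj
        rw [Equiv.swap_apply_of_ne_of_ne hj.1 hj.2]; ring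
    simp only [mul_sub, Finset.sum_sub_distrib] at h3
    nlinarith
  set key : Fin P.n → ℝ ×ₗ ℝ := fun j => toLex (ξ j, -Y j) with hkey
  set σ' := Tuple.sort key with hσ'
  have hms : Monotone (key ∘ σ') := Tuple.monotone_sort key
  have hle : ∀ i j, i ≤ j → ξ (σ' i) < ξ (σ' j) ∨ (ξ (σ' i) = ξ (σ' j) ∧ Y (σ' j) ≤ Y (σ' i)) := by
    intro i j hij
    have h := hms hij
    simp only [hkey, Function.comp, Prod.Lex.toLex_le_toLex] at h
    rcases h with h | ⟨h1, h2⟩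
    · exact Or.inl h
    · exact Or.inr ⟨h1, by linarith⟩
  have hξm : Monotone (ξ ∘ σ') := by
    intro i j hij
    rcases hle i j hij with h | h
    · exact h.le
    · exact h.1.le
  have hξσ : Monotone (ξ ∘ σ) := by
    intro i j hij
    simp only [hξ, Function.comp, Equiv.symm_apply_apply]
    exact (ent_head hl).2.2 _ _ hij (by rw [hlen]; exact j.2)
  have heq : ξ ∘ σ' = ξ ∘ σ := Tuple.unique_monotone hξm hξσ
  have hent : ∀ j, ent q (σ'.symm j) = ξ j := by
    intro j
    have := congrFun heq (σ'.symm j)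
    simp only [hξ, Function.comp, Equiv.symm_apply_apply, Equiv.apply_symm_apply] at this
    exact this.symm
  have hM : P.MinAt (fx (Y ∘ σ')) ([] ++ q) := by
    refine ⟨hl, hlen, ?_, ?_, ?_, ?_⟩
    · intro i hi
      rw [show i = ((⟨i, hi⟩ : Fin P.n) : ℕ) from rfl, fx_fin]; exact hpos _
    · intro i j hij hj
      rw [fx_lt _ hj, fx_lt _ (hij.trans_lt hj)]
      rcases hle ⟨i, hij.trans_lt hj⟩ ⟨j, hj⟩ hij with h | h
      · exact hswap _ _ h
      · exact h.2
    · intro i hi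
      rw [show i = ((⟨i, hi⟩ : Fin P.n) : ℕ) from rfl, fx_fin]; exact hbd _
    · intro q' hq' hlen'
      have h := hmin σ' q' hq' hlen'
      refine le_trans (le_of_eq ?_) h
      change P.phi Y σ' q = _
      rw [phi_eq _ _ hlen, phi_eq _ _ hlen]
      congr 1
      refine Finset.sum_congr rfl fun j _ => ?_
      rw [hent]
  set D : ℕ → ℤ := fun i => if h : i < P.n then d (σ' ⟨i, h⟩) else 0 with hD
  have hDf : (fun i => (D i : ℝ)) = fx ((fun j => (d j : ℝ)) ∘ σ') := by
    funext i
    simp only [hD, fx, Function.comp]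
    split_ifs <;> simp
  have hc := consist G (d := D) (fun i => by
    simp only [hD]; split_ifs
    · exact hd _
    · simp) q [] hM (by
      rw [hDf, dot_perm _ _ hlen]
      simpa only [hent] using hdpos)
  rw [hlen, Finset.sum_range] at hc
  refine hc.trans (le_of_eq ?_)
  rw [← Equiv.sum_comp σ' (fun j => (d j : ℝ) * (-Real.log (Y j)))]
  refine Finset.sum_congr rfl fun i _ => ?_
  rw [fx_fin]
  simp [hD]

theorem finite_legit (m : ℕ) (V : ℝ) : {q : List ℝ | P.Legit q ∧ q.length = m ∧ q.headD 0 ≤ V}.Finite := by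
  induction m with
  | zero =>
    refine (Set.finite_singleton ([] : List ℝ)).subset ?_
    rintro q ⟨-, h, -⟩
    exact List.length_eq_zero_iff.1 h
  | succ m ih =>
    have hfin : (⋃ p ∈ {q : List ℝ | P.Legit q ∧ q.length = m ∧ q.headD 0 ≤ V},
      (fun v => v :: p) '' ((P.walls p : Set ℝ) ∪ (fun z : ℤ => (z : ℝ)) '' Set.Icc 0 ⌊V⌋)).Finite := by
      refine ih.biUnion fun p _ => Set.Finite.image _ ((Finset.finite_toSet _).union
        ((Set.finite_Icc _ _).image _))
    refine hfin.subset ?_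
    rintro q ⟨hl, hlen, hV⟩
    cases q with
    | nil => simp at hlen
    | cons v p =>
      simp only [List.headD_cons, List.length_cons] at hV hlen
      simp only [Set.mem_iUnion]
      refine ⟨p, ⟨hl.1, by omega, hl.2.1.trans hV⟩, v, ?_, rfl⟩
      rcases hl.2.2 with h | ⟨⟨z, hz⟩, -⟩
      · exact Or.inl h
      · refine Or.inr ⟨z, ⟨?_, ?_⟩, hz.symm⟩
        · have : (0 : ℝ) ≤ z := by rw [← hz]; exact (ent_head hl.1).1.trans hl.2.1
          exact_mod_cast this
        · exact Int.le_floor.2 (by rw [← hz]; exact hV)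

theorem ThS_nonneg (G : P.Good) {q : List ℝ} (h : q.length ≤ P.n) : 0 ≤ P.ThS q := by
  induction q with
  | nil => simp [ThS]
  | cons v p ih =>
    simp only [List.length_cons] at h
    have := ih (by omega)
    have := Tht_nonneg G (p := p) (by omega) v
    simp only [ThS]; linarith

theorem phi_ge_head (G : P.Good) {Y : Fin P.n → ℝ} {m : ℝ} (hm : 0 ≤ m) (hY : ∀ j, m ≤ Y j)
    (σ : Equiv.Perm (Fin P.n)) {q : List ℝ} (hl : P.Legit q) (hlen : q.length = P.n) :
    q.headD 0 * m ≤ P.phi Y σ q := by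
  cases q with
  | nil => exact absurd hlen (by have := P.hn; simp; omega)
  | cons v p =>
    simp only [List.headD_cons, List.length_cons] at *
    rw [phi_eq _ _ (by simpa using hlen)]
    have h1 := ThS_nonneg G (q := v :: p) (by simp; omega)
    have h2 : Y (σ ⟨p.length, by omega⟩) * ent (v :: p) (σ.symm (σ ⟨p.length, by omega⟩)) ≤
        ∑ j, Y j * ent (v :: p) (σ.symm j) := by
      refine Finset.single_le_sum (f := fun j => Y j * ent (v :: p) (σ.symm j)) (fun j _ => ?_)
        (Finset.mem_univ _)
      refine mul_nonneg (hm.trans (hY j)) ((ent_head hl).2.1 _ ?_).1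
      simp only [List.length_cons]; rw [hlen]; exact (σ.symm j).2
    rw [Equiv.symm_apply_apply] at h2
    have h2' : ent (v :: p) ((⟨p.length, by omega⟩ : Fin P.n) : ℕ) = v := by simp [ent]
    rw [h2'] at h2
    have h3 : 0 ≤ v := (ent_head hl).1
    have h4 := mul_le_mul_of_nonneg_left (hY (σ ⟨p.length, by omega⟩)) h3
    linarith

def zl (m : ℕ) : List ℝ := List.replicate m 0

theorem combos_zl {M m : ℕ} {x : ℝ} (hx : x ∈ combos M (zl m)) : x = 0 := by
  induction m generalizing x with
  | zero => simpa [zl, combos] using hx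
  | succ m ih =>
    rw [zl, List.replicate_succ] at hx
    obtain ⟨a, _, y, hy, rfl⟩ := mem_combos_cons.1 hx
    rw [ih hy]; simp

theorem walls_zl {m : ℕ} {x : ℝ} (hx : x ∈ P.walls (zl m)) : x = 0 := by
  obtain ⟨c, _, _, y, hy, rfl⟩ := P.mem_walls.1 hx
  rw [combos_zl hy]; simp

theorem zl_head (m : ℕ) : (zl m).headD 0 = 0 := by
  cases m <;> simp [zl, List.replicate_succ]

theorem zl_len (m : ℕ) : (zl m).length = m := by simp [zl]

theorem zl_legit (m : ℕ) : P.Legit (zl m) := by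
  induction m with
  | zero => exact trivial
  | succ m ih =>
    change P.Legit (0 :: zl m)
    exact ⟨ih, (zl_head m).le, Or.inl (P.zero_mem_walls _)⟩

theorem ThS_zl (G : P.Good) (m : ℕ) (hm : m ≤ P.n) : P.ThS (zl m) ≤ m * (2 * (P.s + 1) * Real.exp (-P.s)) := by
  induction m with
  | zero => simp [zl, ThS]
  | succ m ih =>
    change P.Tht (zl m) 0 + P.ThS (zl m) ≤ _
    have h1 := ih (by omega)
    have h2 := Tht_tie G (p := zl m) (by rw [zl_len]; omega) (zl_legit m) (P.zero_mem_walls _)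
    have h3 := s_le_Sc G (zl m) (by rw [zl_len]; omega)
    have h4 := dec_aux (by linarith [G.s10]) h3
    rw [sub_zero] at h2
    push_cast
    linarith

theorem c0_le (G : P.Good) : P.ThS (zl P.n) ≤ 1 / 10 := by
  have h1 := ThS_zl G P.n le_rfl
  have h2 := G.T1 P.s le_rfl
  linarith

theorem legit_zero_or (G : P.Good) (q : List ℝ) (hl : P.Legit q) (hlen : q.length ≤ P.n) :
    q = zl q.length ∨ P.s ≤ q.headD 0 := by
  induction q with
  | nil => left; simp [zl]
  | cons v p ih =>
    simp only [List.length_cons] at hlen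
    rcases ih hl.1 (by omega) with h | h
    · by_cases hv : v ∈ P.walls p
      · left
        rw [h] at hv
        rw [walls_zl hv]
        rw [List.length_cons, zl, List.replicate_succ]
        rw [h]; simp [zl]
      · right
        have h1 := (hl.2.2.resolve_left hv).2 0 (P.zero_mem_walls _)
        have h2 : 0 ≤ v := (ent_head hl).1
        rw [sub_zero, abs_of_nonneg h2] at h1
        simp only [List.headD_cons]
        exact (s_le_Sc G p (by omega)).trans h1
    · right
      simp only [List.headD_cons]
      exact h.trans hl.2.1

theorem phi_zl (Y : Fin P.n → ℝ) (σ : Equiv.Perm (Fin P.n)) : P.phi Y σ (zl P.n) = P.ThS (zl P.n) := by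
  rw [phi_eq _ _ (zl_len _)]
  have : ∀ m i, ent (zl m) i = 0 := by
    intro m
    induction m with
    | zero => intro i; simp [zl, ent]
    | succ m ih =>
      intro i
      change (if i = (zl m).length then 0 else ent (zl m) i) = 0
      rw [ih]; simp
  simp [this]

theorem init_ge (G : P.Good) {Y : Fin P.n → ℝ} {m : ℝ} (hm : 0 ≤ m) (hY : ∀ j, m ≤ Y j)
    (hsm : 1 / 10 ≤ P.s * m)
    (σ : Equiv.Perm (Fin P.n)) {q : List ℝ} (hl : P.Legit q) (hlen : q.length = P.n) :
    P.ThS (zl P.n) ≤ P.phi Y σ q := by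
  rcases legit_zero_or G q hl hlen.le with h | h
  · rw [h, hlen, phi_zl]
  · have h1 := phi_ge_head G hm hY σ hl hlen
    have h2 := c0_le G
    have h3 := mul_le_mul_of_nonneg_right h hm
    linarith

theorem final_ge (G : P.Good) : ∃ ε > 0, ∀ Y : Fin P.n → ℝ, 
    (∀ σ q, P.Legit q → q.length = P.n → P.ThS (zl P.n) ≤ P.phi Y σ q) → ∀ j, ε ≤ Y j := by
  obtain ⟨m, hm⟩ : ∃ m, P.n = m + 1 := ⟨P.n - 1, by have := P.hn; omega⟩
  set S := P.Sc (zl m) with hS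
  have hs := s_le_Sc G (zl m) (by rw [zl_len]; omega)
  have h10 := G.s10
  set V : ℝ := ((⌈S⌉ : ℤ) : ℝ) with hV
  have hV1 : S ≤ V := Int.le_ceil _
  have hV0 : 0 < V := by linarith
  refine ⟨S * Real.exp (-S) / V, div_pos (mul_pos (by linarith) (Real.exp_pos _)) hV0, ?_⟩
  intro Y hY j
  have hfar : ∀ w ∈ P.walls (zl m), S ≤ |V - w| := by
    intro w hw
    rw [walls_zl hw, sub_zero, abs_of_pos hV0]; exact hV1
  have hVn := notwall_of_far G hfar
  have hl : P.Legit (V :: zl m) := ⟨zl_legit m, by rw [zl_head]; exact hV0.le, Or.inr ⟨⟨_, hV⟩, hfar⟩⟩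
  have hlast : m < P.n := by omega
  have h := hY (Equiv.swap ⟨m, hlast⟩ j) (V :: zl m) hl (by rw [List.length_cons, zl_len, hm])
  rw [phi, cost_cons, zl_len] at h
  have hfx : fx (Y ∘ (Equiv.swap ⟨m, hlast⟩ j)) m = Y j := by
    rw [fx_lt _ hlast]; simp
  have hdz : ∀ (f : ℕ → ℝ) k, dot f (zl k) = 0 := by
    intro f k
    induction k with
    | zero => simp [zl, dot]
    | succ k ih =>
      change f _ * 0 + dot f (zl k) = 0
      rw [ih]; simp
  rw [hfx, cost, hdz, zero_add] at h
  have h2 : P.ThS (zl P.n) = P.Tht (zl m) 0 + P.ThS (zl m) := by rw [hm]; rfl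
  have h3 := Tht_up (P := P) (p := zl m) (P.zero_mem_walls _) hVn hV0
    (fun w' hw' => Or.inl (walls_zl hw').le)
  rw [sub_zero, ← hS] at h3
  have h4 : Real.exp (-V) ≤ Real.exp (-S) := Real.exp_le_exp.2 (by linarith)
  rw [div_le_iff₀ hV0]
  linarith

end Par
end GP

open Finset Filter

namespace GP

theorem exists_good (n N0 : ℕ) (hn : 1 ≤ n) (hN0 : 1 ≤ N0) (K B : ℝ) :
    ∃ s L c1 : ℝ, (⟨n, N0, s, L, c1, K, hn, hN0⟩ : Par).Good ∧ B ≤ s := by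
  have hnR : (1 : ℝ) ≤ n := by exact_mod_cast hn
  set Nb : ℕ := Par.Nrec N0 n with hNb
  have e1 : ∀ᶠ T : ℝ in atTop, 2 * (n : ℝ) * (T + 1) * Real.exp (-T) ≤ 1 / 10 := by
    have h1 := Real.tendsto_pow_mul_exp_neg_atTop_nhds_zero 1
    have h0 := Real.tendsto_pow_mul_exp_neg_atTop_nhds_zero 0
    have h := (h1.add h0).const_mul (2 * (n : ℝ))
    simp only [add_zero, mul_zero] at h
    filter_upwards [h.eventually (ge_mem_nhds (show (0 : ℝ) < 1 / 10 by norm_num))] with T hT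
    calc _ = 2 * (n : ℝ) * (T ^ 1 * Real.exp (-T) + T ^ 0 * Real.exp (-T)) := by ring
      _ ≤ _ := hT
  have e2 : ∀ᶠ T : ℝ in atTop, ((Nb * (2 * Nb + 1) ^ n : ℕ) : ℝ) * Real.exp (-(8 * T)) ≤ 1 / 2 := by
    have h0 : Tendsto (fun T : ℝ => Real.exp (-(8 * T))) atTop (nhds 0) :=
      Real.tendsto_exp_neg_atTop_nhds_zero.comp (tendsto_id.const_mul_atTop (by norm_num : (0:ℝ) < 8))
    have h := h0.const_mul (((Nb * (2 * Nb + 1) ^ n : ℕ) : ℝ))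
    simp only [mul_zero] at h
    exact h.eventually (ge_mem_nhds (show (0 : ℝ) < 1 / 2 by norm_num))
  obtain ⟨a1, ha1⟩ := eventually_atTop.1 e1
  obtain ⟨a2, ha2⟩ := eventually_atTop.1 e2
  set c1 := Real.log (20 * n) with hc1
  obtain ⟨s, hs⟩ : ∃ s : ℝ, 10 ≤ s ∧ a1 ≤ s ∧ a2 ≤ s ∧ K ≤ s ∧ B ≤ s ∧ 32 * n * N0 * c1 ≤ s :=
    ⟨max 10 (max a1 (max a2 (max K (max B (32 * n * N0 * c1))))), by simp⟩
  obtain ⟨s1, s2, s3, s4, s5, s6⟩ := hs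
  refine ⟨s, 10 * (Nb : ℝ) ^ (n + 2) + 32 * n * N0, c1, ⟨s1, ?_, ?_, s6, ?_, s4, ?_, ?_⟩, s5⟩
  · change 10 * (Nb : ℝ) ^ (n + 2) ≤ 10 * (Nb : ℝ) ^ (n + 2) + 32 * n * N0
    have : (0 : ℝ) ≤ 32 * n * N0 := by positivity
    linarith
  · change 32 * (n : ℝ) * N0 ≤ 10 * (Nb : ℝ) ^ (n + 2) + 32 * n * N0
    have : (0 : ℝ) ≤ 10 * (Nb : ℝ) ^ (n + 2) := by positivity
    linarith
  · change 20 * (n : ℝ) ≤ Real.exp c1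
    rw [hc1, Real.exp_log (by linarith)]
  · intro T hT; exact ha1 T (s2.trans hT)
  · intro T hT; exact ha2 T (s3.trans hT)

theorem right_gt {g : ℝ → ℝ} {g' t : ℝ} (h : HasDerivAt g g' t) (hg : 0 < g') :
    ∀ᶠ u in nhdsWithin t (Set.Ioi t), g t < g u := by
  have h1 := (hasDerivAt_iff_tendsto_slope.1 h).mono_left
    (nhdsWithin_mono t (fun u (hu : t < u) => ne_of_gt hu))
  filter_upwards [h1.eventually (lt_mem_nhds hg), self_mem_nhdsWithin] with u hu htu
  have htu' : t < u := htu
  rw [slope_def_field] at hu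
  have := (div_pos_iff_of_pos_right (sub_pos.2 htu')).1 hu
  linarith

theorem static_dyn {n : ℕ} (hn : 1 ≤ n) (N0 : ℕ) (hN0 : 1 ≤ N0) (K δ : ℝ) (Y Y' : ℝ → Fin n → ℝ) (t0 : ℝ)
    (hder : ∀ t ≥ t0, HasDerivAt Y (Y' t) t) (hpos : ∀ t ≥ t0, ∀ j, 0 < Y t j)
    (hK : ∀ t ≥ t0, ∀ j, Y t j ≤ Real.exp K)
    (H : ∀ t ≥ t0, ∀ ξ : Fin n → ℝ,
      (∀ d : Fin n → ℤ, (∀ j, |d j| ≤ N0) → 0 < ∑ j, (d j : ℝ) * ξ j →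
        δ ≤ ∑ j, (d j : ℝ) * (-Real.log (Y t j))) → 0 ≤ ∑ j, Y' t j * ξ j) :
    ∃ ε > 0, ∀ t ≥ t0, ∀ j, ε ≤ Y t j := by
  have hne : Nonempty (Fin n) := ⟨⟨0, by omega⟩⟩
  obtain ⟨j0, hj0⟩ := Finite.exists_min (Y t0)
  have hm0 := hpos t0 le_rfl j0
  obtain ⟨s, L, c1, G, hB⟩ := exists_good n N0 hn hN0 K (max (4 * δ) (1 / 10 / Y t0 j0))
  have hs1 : 4 * δ ≤ s := (le_max_left _ _).trans hB
  have hs2 : 1 / 10 ≤ s * Y t0 j0 := by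
    rw [← div_le_iff₀ hm0]; exact (le_max_right _ _).trans hB
  set P : Par := ⟨n, N0, s, L, c1, K, hn, hN0⟩ with hP
  obtain ⟨ε, hε, hfin⟩ := Par.final_ge G
  refine ⟨ε, hε, fun t ht => hfin (Y t) ?_⟩
  set c0 := P.ThS (Par.zl P.n) with hc0
  -- key claim
  have key : ∀ e > 0, ∀ T ≥ t0, ∀ u ∈ Set.Icc t0 T, ∀ (σ : Equiv.Perm (Fin P.n)) (q : List ℝ), P.Legit q → q.length = P.n →
      c0 ≤ P.phi (Y u) σ q + e * (u - t0) := by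
    intro e he T hT
    have hcont : ContinuousOn Y (Set.Icc t0 T) := fun u hu => (hder u hu.1).continuousAt.continuousWithinAt
    have hlow : ∃ m > 0, ∀ u ∈ Set.Icc t0 T, ∀ j, m ≤ Y u j := by
      have : ∀ j, ∃ m > 0, ∀ u ∈ Set.Icc t0 T, m ≤ Y u j := by
        intro j
        obtain ⟨u, hu, hmin⟩ := isCompact_Icc.exists_isMinOn ⟨t0, Set.left_mem_Icc.2 hT⟩
          ((continuousOn_pi.1 hcont) j)
        exact ⟨Y u j, hpos u hu.1 j, fun u' hu' => hmin hu'⟩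
      choose m hm hm' using this
      obtain ⟨j1, hj1⟩ := Finite.exists_min m
      exact ⟨m j1, hm j1, fun u hu j => (hj1 j).trans (hm' j u hu)⟩
    obtain ⟨m, hm, hmY⟩ := hlow
    set F := {q : List ℝ | P.Legit q ∧ q.length = P.n ∧ q.headD 0 ≤ c0 / m} with hF
    have hFfin : F.Finite := P.finite_legit P.n (c0 / m)
    have houtside : ∀ u ∈ Set.Icc t0 T, ∀ (σ : Equiv.Perm (Fin P.n)) (q : List ℝ), P.Legit q → q.length = P.n → q ∉ F →
        c0 ≤ P.phi (Y u) σ q + e * (u - t0) := by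
      intro u hu σ q hq hlen hqF
      have h1 : c0 / m < q.headD 0 := by
        by_contra hcon
        exact hqF ⟨hq, hlen, not_lt.1 hcon⟩
      have h2 := Par.phi_ge_head G hm.le (hmY u hu) σ hq hlen
      rw [div_lt_iff₀ hm] at h1
      have : 0 ≤ e * (u - t0) := mul_nonneg he.le (sub_nonneg.2 hu.1)
      linarith
    have hphider : ∀ (σ : Equiv.Perm (Fin P.n)) (q : List ℝ), q.length = P.n → ∀ u ≥ t0,
        HasDerivAt (fun u => P.phi (Y u) σ q + e * (u - t0))
          (∑ j, Y' u j * ent q (σ.symm j) + e) u := by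
      intro σ q hlen u hu
      have h1 : (fun u => P.phi (Y u) σ q + e * (u - t0)) =
          fun u => (∑ j, Y u j * ent q (σ.symm j) + P.ThS q) + e * (u - t0) := by
        funext u; rw [Par.phi_eq _ _ hlen]
      rw [h1]
      have h2 : HasDerivAt (fun u => ∑ j, Y u j * ent q (σ.symm j)) (∑ j, Y' u j * ent q (σ.symm j)) u := by
        refine HasDerivAt.fun_sum fun j _ => ?_
        exact ((hasDerivAt_pi.1 (hder u hu)) j).mul_const _
      have h3 : HasDerivAt (fun u : ℝ => e * (u - t0)) e u := by
        simpa using ((hasDerivAt_id u).sub_const t0).const_mul e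
      exact (h2.add_const _).add h3
    set A := {u : ℝ | ∀ (σ : Equiv.Perm (Fin P.n)), ∀ q ∈ F, c0 ≤ P.phi (Y u) σ q + e * (u - t0)} with hA
    have hsub : Set.Icc t0 T ⊆ A := by
      refine IsClosed.Icc_subset_of_forall_exists_gt ?_ ?_ ?_
      · have : A ∩ Set.Icc t0 T = Set.Icc t0 T ∩ ⋂ (σ : Equiv.Perm (Fin P.n)), ⋂ q ∈ F,
            (Set.Icc t0 T ∩ (fun u => P.phi (Y u) σ q + e * (u - t0)) ⁻¹' Set.Ici c0) := by
          ext u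
          simp only [hA, Set.mem_inter_iff, Set.mem_setOf_eq, Set.mem_iInter, Set.mem_preimage,
            Set.mem_Ici]
          constructor
          · rintro ⟨h1, h2⟩
            exact ⟨h2, fun σ q hq => ⟨h2, h1 σ q hq⟩⟩
          · rintro ⟨h1, h2⟩
            exact ⟨fun σ q hq => (h2 σ q hq).2, h1⟩
        rw [this]
        refine isClosed_Icc.inter (isClosed_iInter fun σ => isClosed_biInter fun q hq => ?_)
        refine ContinuousOn.preimage_isClosed_of_isClosed ?_ isClosed_Icc isClosed_Ici
        exact fun u hu => (hphider σ q hq.2.1 u hu.1).continuousAt.continuousWithinAt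
      · intro σ q hq
        have := Par.init_ge G hm0.le hj0 hs2 σ hq.1 hq.2.1
        simpa using this
      · rintro u ⟨huA, hu⟩ y hy
        have hev : ∀ σ : Equiv.Perm (Fin P.n), ∀ q ∈ F, ∀ᶠ v in nhdsWithin u (Set.Ioi u),
            c0 ≤ P.phi (Y v) σ q + e * (v - t0) := by
          intro σ q hq
          have hd := hphider σ q hq.2.1 u hu.1
          rcases (huA σ q hq).lt_or_eq with hlt | heq
          · have := hd.continuousAt.continuousWithinAt (s := Set.Ioi u)
            filter_upwards [this.eventually (lt_mem_nhds hlt)] with v hv using hv.le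
          · have hmin : ∀ σ' q', P.Legit q' → q'.length = P.n → P.phi (Y u) σ q ≤ P.phi (Y u) σ' q' := by
              intro σ' q' hq' hlen'
              have h1 : c0 ≤ P.phi (Y u) σ' q' + e * (u - t0) := by
                by_cases hF' : q' ∈ F
                · exact huA σ' q' hF'
                · exact houtside u ⟨hu.1, hu.2.le⟩ σ' q' hq' hlen' hF'
              linarith
            have h0 := H u hu.1 (fun j => ent q (σ.symm j)) (fun d hd hdp => by
              have := Par.core G (hpos u hu.1) (hK u hu.1) hq.1 hq.2.1 hmin hd hdp
              have h4 : P.s = s := rfl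
              rw [h4] at this
              linarith)
            have := right_gt hd (by linarith)
            filter_upwards [this] with v hv
            linarith
        have hall : ∀ᶠ v in nhdsWithin u (Set.Ioi u), v ∈ A := by
          have : ∀ᶠ v in nhdsWithin u (Set.Ioi u), ∀ σ : Equiv.Perm (Fin P.n), ∀ q ∈ F, 
              c0 ≤ P.phi (Y v) σ q + e * (v - t0) := by
            rw [eventually_all]
            intro σ
            exact (eventually_all_finite hFfin).2 (hev σ)
          exact this
        have hIoc : ∀ᶠ v in nhdsWithin u (Set.Ioi u), v ∈ Set.Ioc u y := Ioc_mem_nhdsGT hy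
        obtain ⟨v, hv⟩ := (hall.and hIoc).exists
        exact ⟨v, hv⟩
    intro u hu σ q hq hlen
    by_cases hF' : q ∈ F
    · exact hsub hu σ q hF'
    · exact houtside u hu σ q hq hlen hF'
  intro σ q hq hlen
  refine le_of_forall_pos_le_add fun e he => ?_
  have h1 := key (e / (t - t0 + 1)) (by have : 0 < t - t0 + 1 := by linarith
                                        positivity) t ht t ⟨ht, le_rfl⟩ σ q hq hlen
  refine h1.trans ?_
  have h2 : e / (t - t0 + 1) * (t - t0) ≤ e := by
    have h3 : 0 < t - t0 + 1 := by linarith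
    rw [div_mul_eq_mul_div, div_le_iff₀ h3]
    nlinarith
  linarith

end GP

open Finset Filter
namespace GP

theorem cut_sum {r : ℕ} (p q κ ρ : Fin r → ℝ) (hκ : ∀ i, 0 < κ i) (hρ : ∀ i, 0 < ρ i)
    (hbal : ∀ F : ℝ → ℝ, ∑ i, κ i * F (q i) = ∑ i, κ i * F (p i))
    (hanti : ∀ i i', p i' < p i → ρ i ≤ ρ i') :
    0 ≤ ∑ i, κ i * ρ i * (q i - p i) := by
  rcases Nat.eq_zero_or_pos r with h0 | hr
  · subst h0; simp
  have : Nonempty (Fin r) := ⟨⟨0, hr⟩⟩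
  have hB : ∀ i, ρ i ≤ ∑ i, ρ i := fun i =>
    Finset.single_le_sum (f := ρ) (fun j _ => (hρ j).le) (Finset.mem_univ i)
  set B := ∑ i, ρ i with hBdef
  set φ : ℝ → ℝ := fun c => Finset.univ.inf' Finset.univ_nonempty
    (fun i => if p i < c then ρ i else B) with hφ
  have h1 : ∀ i c, p i < c → φ c ≤ ρ i := by
    intro i c h
    refine (Finset.inf'_le _ (Finset.mem_univ i)).trans ?_
    simp [h]
  have h2 : ∀ i c, c ≤ p i → ρ i ≤ φ c := by
    intro i c h
    refine Finset.le_inf' _ _ ?_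
    intro i' _
    split_ifs with h'
    · exact hanti i i' (lt_of_lt_of_le h' h)
    · exact hB i
  have hA : Antitone φ := by
    intro c c' hc
    refine Finset.le_inf' _ _ ?_
    intro i _
    refine (Finset.inf'_le _ (Finset.mem_univ i)).trans ?_
    by_cases h : p i < c
    · rw [if_pos h, if_pos (lt_of_lt_of_le h hc)]
    · rw [if_neg h]
      split_ifs
      · exact hB i
      · exact le_rfl
  have hint : ∀ a b, IntervalIntegrable φ MeasureTheory.volume a b := fun a b => hA.intervalIntegrable
  set F : ℝ → ℝ := fun z => ∫ c in (0:ℝ)..z, φ c with hF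
  have hFd : ∀ a b, F b - F a = ∫ c in a..b, φ c := fun a b =>
    intervalIntegral.integral_interval_sub_left (hint _ _) (hint _ _)
  have key : ∀ i, F (q i) - F (p i) ≤ ρ i * (q i - p i) := by
    intro i
    rcases le_total (p i) (q i) with h | h
    · rw [hFd]
      have := intervalIntegral.integral_mono_on_of_le_Ioo (f := φ) (g := fun _ => ρ i) h (hint _ _)
        (by simp) (fun c hc => h1 i c hc.1)
      simp only [intervalIntegral.integral_const, smul_eq_mul] at this
      linarith
    · have e : F (q i) - F (p i) = -(F (p i) - F (q i)) := by ring
      rw [e, hFd]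
      have := intervalIntegral.integral_mono_on_of_le_Ioo (g := φ) (f := fun _ => ρ i) h
        (by simp) (hint _ _) (fun c hc => h2 i c hc.2.le)
      simp only [intervalIntegral.integral_const, smul_eq_mul] at this
      linarith
  have hs : ∑ i, κ i * (F (q i) - F (p i)) = 0 := by
    simp only [mul_sub, Finset.sum_sub_distrib]
    rw [hbal F, sub_self]
  rw [← hs]
  refine Finset.sum_le_sum fun i _ => ?_
  have := mul_le_mul_of_nonneg_left (key i) (hκ i).le
  linarith

theorem cb_sum {n r : ℕ} (y y' : Fin r → Fin n → ℕ) (κ : Fin r → ℝ)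
    (h : ∀ η : Fin n → ℕ, ∑ i ∈ Finset.univ.filter (fun i => y i = η), κ i
      = ∑ i ∈ Finset.univ.filter (fun i => y' i = η), κ i) (G : (Fin n → ℕ) → ℝ) :
    ∑ i, κ i * G (y' i) = ∑ i, κ i * G (y i) := by
  classical
  set T : Finset (Fin n → ℕ) := Finset.univ.image y ∪ Finset.univ.image y'
  have e : ∀ z : Fin r → Fin n → ℕ, (∀ i, z i ∈ T) → ∑ i, κ i * G (z i) =
      ∑ η ∈ T, (∑ i ∈ Finset.univ.filter (fun i => z i = η), κ i) * G η := by
    intro z hz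
    rw [← Finset.sum_fiberwise_of_maps_to (t := T) (g := z) (fun i _ => hz i)]
    refine Finset.sum_congr rfl fun η _ => ?_
    rw [Finset.sum_mul]
    refine Finset.sum_congr rfl fun i hi => ?_
    rw [(Finset.mem_filter.1 hi).2]
  rw [e y' (fun i => by simp [T]), e y (fun i => by simp [T])]
  refine Finset.sum_congr rfl fun η _ => ?_
  rw [h]

theorem mono_pos {n : ℕ} {x : Fin n → ℝ} (hx : ∀ j, 0 < x j) (y : Fin n → ℕ) : 0 < mono x y :=
  Finset.prod_pos fun j _ => pow_pos (hx j) _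

theorem mono_le_single {n : ℕ} {x : Fin n → ℝ} {M : ℝ} (hM : 1 ≤ M) (hx : ∀ j, 0 ≤ x j)
    (hxM : ∀ j, x j ≤ M) (y : Fin n → ℕ) (N : ℕ) (hN : ∑ j, y j ≤ N) (j : Fin n) (hj : y j ≠ 0) :
    mono x y ≤ M ^ N * x j := by
  classical
  have h1 : x j ^ y j ≤ M ^ y j * x j := by
    obtain ⟨a, ha⟩ := Nat.exists_eq_succ_of_ne_zero hj
    rw [ha, Nat.succ_eq_add_one, pow_succ]
    refine mul_le_mul_of_nonneg_right ?_ (hx j)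
    exact (pow_le_pow_left₀ (hx j) (hxM j) a).trans (pow_le_pow_right₀ hM (Nat.le_succ a))
  have h2 : ∏ l ∈ Finset.univ.erase j, x l ^ y l ≤ ∏ l ∈ Finset.univ.erase j, M ^ y l :=
    Finset.prod_le_prod (fun l _ => pow_nonneg (hx l) _) (fun l _ => pow_le_pow_left₀ (hx l) (hxM l) _)
  have hM0 : (0:ℝ) ≤ M := by linarith
  unfold mono
  rw [← Finset.mul_prod_erase _ _ (Finset.mem_univ j)]
  calc _ ≤ (M ^ y j * x j) * ∏ l ∈ Finset.univ.erase j, M ^ y l :=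
        mul_le_mul h1 h2 (Finset.prod_nonneg fun l _ => pow_nonneg (hx l) _)
          (mul_nonneg (pow_nonneg hM0 _) (hx j))
    _ = (M ^ y j * ∏ l ∈ Finset.univ.erase j, M ^ y l) * x j := by ring
    _ = M ^ (∑ l, y l) * x j := by
        rw [Finset.mul_prod_erase _ (fun l => M ^ y l) (Finset.mem_univ j), Finset.prod_pow_eq_pow_sum]
    _ ≤ _ := mul_le_mul_of_nonneg_right (pow_le_pow_right₀ hM hN) (hx j)

theorem mono_comp {n : ℕ} {x z : Fin n → ℝ} {C : ℝ} (hC : 1 ≤ C) (hx : ∀ j, 0 ≤ x j)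
    (hz : ∀ j, 0 ≤ z j) (y : Fin n → ℕ) (N : ℕ) (hN : ∑ j, y j ≤ N)
    (h : ∀ j, y j ≠ 0 → x j ≤ C * z j) : mono x y ≤ C ^ N * mono z y := by
  have h1 : mono x y ≤ ∏ j, (C * z j) ^ y j := by
    refine Finset.prod_le_prod (fun l _ => pow_nonneg (hx l) _) (fun l _ => ?_)
    by_cases hl : y l = 0
    · simp [hl]
    · exact pow_le_pow_left₀ (hx l) (h l hl) _
  refine h1.trans ?_
  simp only [mul_pow, Finset.prod_mul_distrib, Finset.prod_pow_eq_pow_sum]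
  exact mul_le_mul_of_nonneg_right (pow_le_pow_right₀ hC hN)
    (Finset.prod_nonneg fun l _ => pow_nonneg (hz l) _)

theorem log_mono {n : ℕ} {x : Fin n → ℝ} (hx : ∀ j, 0 < x j) (y : Fin n → ℕ) :
    Real.log (mono x y) = ∑ j, (y j : ℝ) * Real.log (x j) := by
  unfold mono
  rw [Real.log_prod (fun j _ => (pow_pos (hx j) _).ne')]
  simp [Real.log_pow]

/-- The data of a positive bounded solution. -/
structure Sys {n r : ℕ} (y y' : Fin r → Fin n → ℕ) (k τ : Fin r → ℝ) (τm : ℝ)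
    (x : ℝ → Fin n → ℝ) (P : Fin r → ℝ → ℝ) (c M : ℝ) (N : ℕ) : Prop where
  hk : ∀ i, 0 < k i
  hτ : ∀ i, 0 ≤ τ i
  hτm : ∀ i, τ i ≤ τm
  hτm0 : 0 ≤ τm
  hM : 1 ≤ M
  hc : 0 ≤ c
  hN : ∀ i, ∑ j, y i j ≤ N
  pos : ∀ t ≥ -τm, ∀ j, 0 < x t j
  bd : ∀ t ≥ -τm, ∀ j, x t j ≤ M
  out : ∀ t ≥ -τm, ∀ j, ∑ i, k i * (mono (x t) (y i) * (y i j : ℝ)) ≤ c * x t j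
  dec : ∀ s t, 0 ≤ s → s ≤ t → ∀ j, x s j ≤ Real.exp (c * (t - s)) * x t j
  hP : ∀ i, ∀ t ≥ 0, HasDerivAt (P i) (mono (x t) (y i)) t
  hx : ∀ j, ∀ t > 0, HasDerivAt (fun t => x t j)
    (∑ i, k i * (mono (x (t - τ i)) (y i) * (y' i j : ℝ) - mono (x t) (y i) * (y i j : ℝ))) t

end GP

open Finset Filter
namespace GP

theorem mono_cont {n : ℕ} {f : ℝ → Fin n → ℝ} (hf : Continuous f) (y : Fin n → ℕ) :
    Continuous fun t => mono (f t) y := by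
  unfold mono
  fun_prop

theorem monoOn_of_deriv {f f' : ℝ → ℝ} {a b : ℝ} (hc : ContinuousOn f (Set.Icc a b))
    (hd : ∀ t ∈ Set.Ioo a b, HasDerivAt f (f' t) t) (h0 : ∀ t ∈ Set.Ioo a b, 0 ≤ f' t) (hab : a ≤ b) :
    f a ≤ f b := by
  have := monotoneOn_of_deriv_nonneg (convex_Icc a b) hc
    (by rw [interior_Icc]; exact fun t ht => (hd t ht).differentiableAt.differentiableWithinAt)
    (by rw [interior_Icc]; intro t ht; rw [(hd t ht).deriv]; exact h0 t ht)
  exact this (Set.left_mem_Icc.2 hab) (Set.right_mem_Icc.2 hab) hab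

theorem exists_sys {n r : ℕ} (y y' : Fin r → Fin n → ℕ)
    (k τ : Fin r → ℝ) (τm : ℝ)
    (hk : ∀ i, 0 < k i) (hτ : ∀ i, 0 ≤ τ i) (hτm : ∀ i, τ i ≤ τm) (hτm0 : 0 ≤ τm)
    (x : ℝ → Fin n → ℝ) (hx : IsSolution y y' k τ τm x)
    (hxpos : PosInit τm x) (hxbdd : BoundedSol τm x) :
    ∃ P c M N, Sys y y' k τ τm x P c M N := by
  obtain ⟨hnn, hcont, hder⟩ := hx
  obtain ⟨M0, hM0⟩ := hxbdd
  set M := max M0 1 with hMd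
  have hM : 1 ≤ M := le_max_right _ _
  have bd : ∀ t ≥ -τm, ∀ j, x t j ≤ M := fun t ht j =>
    (le_abs_self _).trans ((norm_le_pi_norm (x t) j).trans ((hM0 t ht).trans (le_max_left _ _)))
  have nn : ∀ t ≥ -τm, ∀ j, 0 ≤ x t j := hnn
  set N := ∑ i, ∑ j, y i j with hNd
  have hN : ∀ i, ∑ j, y i j ≤ N := fun i =>
    Finset.single_le_sum (f := fun i => ∑ j, y i j) (fun _ _ => Nat.zero_le _) (Finset.mem_univ i)
  set c := ∑ i, k i * (M ^ N * N) with hcd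
  have hMN : 0 ≤ M ^ N := pow_nonneg (by linarith) _
  have hc : 0 ≤ c := Finset.sum_nonneg fun i _ =>
    mul_nonneg (hk i).le (mul_nonneg hMN (Nat.cast_nonneg _))
  have mnn : ∀ t ≥ -τm, ∀ i, 0 ≤ mono (x t) (y i) := fun t ht i =>
    Finset.prod_nonneg fun j _ => pow_nonneg (nn t ht j) _
  have out : ∀ t ≥ -τm, ∀ j, ∑ i, k i * (mono (x t) (y i) * (y i j : ℝ)) ≤ c * x t j := by
    intro t ht j
    rw [hcd, Finset.sum_mul]
    refine Finset.sum_le_sum fun i _ => ?_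
    rw [mul_assoc]
    refine mul_le_mul_of_nonneg_left ?_ (hk i).le
    by_cases hij : y i j = 0
    · simp only [hij, Nat.cast_zero, mul_zero]
      exact mul_nonneg (mul_nonneg hMN (Nat.cast_nonneg _)) (nn t ht j)
    · have h1 := mono_le_single hM (nn t ht) (bd t ht) (y i) N (hN i) j hij
      have h2 : (y i j : ℝ) ≤ N := by
        exact_mod_cast (Finset.single_le_sum (f := y i) (fun _ _ => Nat.zero_le _) (Finset.mem_univ j)).trans (hN i)
      calc _ ≤ (M ^ N * x t j) * N := mul_le_mul h1 h2 (Nat.cast_nonneg _) (mul_nonneg hMN (nn t ht j))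
        _ = _ := by ring
  have hxj : ∀ j, ∀ t > 0, HasDerivAt (fun t => x t j)
    (∑ i, k i * (mono (x (t - τ i)) (y i) * (y' i j : ℝ) - mono (x t) (y i) * (y i j : ℝ))) t :=
    fun j t ht => (hasDerivAt_pi.1 (hder t ht)) j
  have hcj : ∀ j, ContinuousOn (fun t => x t j) (Set.Ici (-τm)) := fun j =>
    (continuousOn_pi.1 hcont) j
  have dec : ∀ s t, 0 ≤ s → s ≤ t → ∀ j, x s j ≤ Real.exp (c * (t - s)) * x t j := by
    intro s t hs hst j
    have := monoOn_of_deriv (f := fun u => Real.exp (c * (u - s)) * x u j)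
      (f' := fun u => Real.exp (c * (u - s)) * c * x u j + Real.exp (c * (u - s)) *
        (∑ i, k i * (mono (x (u - τ i)) (y i) * (y' i j : ℝ) - mono (x u) (y i) * (y i j : ℝ))))
      (a := s) (b := t)
      (ContinuousOn.mul (by fun_prop) ((hcj j).mono (fun u hu => by
        have := hu.1; simp only [Set.mem_Ici]; linarith)))
      (by
        intro u hu
        have hu0 : 0 < u := lt_of_le_of_lt hs hu.1
        have he : HasDerivAt (fun u => Real.exp (c * (u - s))) (Real.exp (c * (u - s)) * c) u := by
          have := (((hasDerivAt_id u).sub_const s).const_mul c).exp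
          simpa using this
        exact he.mul (hxj j u hu0))
      (by
        intro u hu
        have hu0 : 0 < u := lt_of_le_of_lt hs hu.1
        have h1 := out u (by linarith) j
        have h2 : -(∑ i, k i * (mono (x u) (y i) * (y i j : ℝ))) ≤
           ∑ i, k i * (mono (x (u - τ i)) (y i) * (y' i j : ℝ) - mono (x u) (y i) * (y i j : ℝ)) := by
          rw [← Finset.sum_neg_distrib]
          refine Finset.sum_le_sum fun i _ => ?_
          have := mul_nonneg (hk i).le (mul_nonneg (mnn (u - τ i) (by linarith [hτm i]) i)
            (Nat.cast_nonneg (α := ℝ) (y' i j)))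
          linarith
        have h3 := Real.exp_pos (c * (u - s))
        have : 0 ≤ Real.exp (c * (u - s)) * (c * x u j + ∑ i, k i * (mono (x (u - τ i)) (y i) * (y' i j : ℝ) - mono (x u) (y i) * (y i j : ℝ))) :=
          mul_nonneg h3.le (by linarith)
        linarith) hst
    simpa using this
  have pos : ∀ t ≥ -τm, ∀ j, 0 < x t j := by
    intro t ht j
    rcases le_total t 0 with h | h
    · exact hxpos t ⟨ht, h⟩ j
    · have h1 := dec 0 t le_rfl h j
      have h2 := hxpos 0 ⟨by linarith, le_rfl⟩ j
      exact pos_of_mul_pos_right (lt_of_lt_of_le h2 h1) (Real.exp_pos _).le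
  have hcg : Continuous fun t => x (max t (-τm)) := by
    refine hcont.comp_continuous (by fun_prop) ?_
    intro t; show -τm ≤ max t (-τm); exact le_max_right _ _
  refine ⟨fun i t => ∫ s in (0:ℝ)..t, mono (x (max s (-τm))) (y i), c, M, N,
    ⟨hk, hτ, hτm, hτm0, hM, hc, hN, pos, bd, out, dec, ?_, hxj⟩⟩
  intro i t ht
  have h1 := mono_cont hcg (y i)
  have h2 := intervalIntegral.integral_hasDerivAt_right (h1.intervalIntegrable 0 t)
    (h1.stronglyMeasurableAtFilter _ _) h1.continuousAt
  rwa [max_eq_left (by linarith)] at h2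

end GP

open Finset Filter
namespace GP
namespace Sys
variable {n r : ℕ} {y y' : Fin r → Fin n → ℕ} {k τ : Fin r → ℝ} {τm : ℝ}
    {x : ℝ → Fin n → ℝ} {P : Fin r → ℝ → ℝ} {c M : ℝ} {N : ℕ}

theorem mp (h : Sys y y' k τ τm x P c M N) (t : ℝ) (ht : -τm ≤ t) (i : Fin r) :
    0 < mono (x t) (y i) := mono_pos (h.pos t ht) _

theorem hPs (h : Sys y y' k τ τm x P c M N) (i : Fin r) (t : ℝ) (ht : τm ≤ t) :
    HasDerivAt (fun u => P i (u - τ i)) (mono (x (t - τ i)) (y i)) t := by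
  have h1 := h.hP i (t - τ i) (by linarith [h.hτm i])
  exact HasDerivAt.comp_sub_const t (τ i) h1

theorem Pmono (h : Sys y y' k τ τm x P c M N) (i : Fin r) (s t : ℝ) (hs : 0 ≤ s) (hst : s ≤ t) :
    P i s ≤ P i t := by
  refine monoOn_of_deriv (f' := fun u => mono (x u) (y i)) ?_ ?_ ?_ hst
  · exact fun u hu => (h.hP i u (hs.trans hu.1)).continuousAt.continuousWithinAt
  · exact fun u hu => h.hP i u (hs.trans hu.1.le)
  · exact fun u hu => (h.mp u (by linarith [hu.1, h.hτm0]) i).le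

theorem arr (h : Sys y y' k τ τm x P c M N) (i : Fin r) (j : Fin n) (t : ℝ) (ht : τm + 1 ≤ t) :
    k i * (y' i j : ℝ) * (P i (t + 1) - P i (t - τ i)) ≤
      Real.exp (c * (τm + 1)) * x (t + (τm + 1)) j := by
  have h0 := h.hτm0
  have hki := (h.hk i).le
  have hy : (0:ℝ) ≤ y' i j := Nat.cast_nonneg _
  have hD : ∀ u ≥ t, HasDerivAt (fun u => Real.exp (c * (u - t)) * x u j - k i * (y' i j : ℝ) * P i (u - τ i))
      (Real.exp (c * (u - t)) * c * x u j + Real.exp (c * (u - t)) *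
        (∑ i, k i * (mono (x (u - τ i)) (y i) * (y' i j : ℝ) - mono (x u) (y i) * (y i j : ℝ)))
        - k i * (y' i j : ℝ) * mono (x (u - τ i)) (y i)) u := by
    intro u hu
    have he : HasDerivAt (fun u => Real.exp (c * (u - t))) (Real.exp (c * (u - t)) * c) u := by
      have := (((hasDerivAt_id u).sub_const t).const_mul c).exp
      simpa using this
    exact (he.mul (h.hx j u (by linarith))).sub ((h.hPs i u (by linarith)).const_mul _)
  have key := monoOn_of_deriv (a := t) (b := t + (τm + 1))
    (fun u hu => (hD u hu.1).continuousAt.continuousWithinAt) (fun u hu => hD u hu.1.le)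
    (by
      intro u hu
      have hu1 := hu.1
      have h1 := h.out u (by linarith) j
      have h2 : k i * (mono (x (u - τ i)) (y i) * (y' i j : ℝ)) - (∑ i, k i * (mono (x u) (y i) * (y i j : ℝ))) ≤
           ∑ i, k i * (mono (x (u - τ i)) (y i) * (y' i j : ℝ) - mono (x u) (y i) * (y i j : ℝ)) := by
        simp only [mul_sub, Finset.sum_sub_distrib]
        refine sub_le_sub_right ?_ _
        exact Finset.single_le_sum (f := fun i => k i * (mono (x (u - τ i)) (y i) * (y' i j : ℝ)))
          (fun i _ => mul_nonneg (h.hk i).le (mul_nonneg (h.mp _ (by linarith [h.hτm i]) i).le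
            (Nat.cast_nonneg _))) (Finset.mem_univ i)
      have h3 : 1 ≤ Real.exp (c * (u - t)) :=
        Real.one_le_exp (mul_nonneg h.hc (by linarith))
      have h4 : 0 ≤ k i * (mono (x (u - τ i)) (y i) * (y' i j : ℝ)) :=
        mul_nonneg hki (mul_nonneg (h.mp _ (by linarith [h.hτm i]) i).le hy)
      have h5 : Real.exp (c * (u - t)) * (k i * (mono (x (u - τ i)) (y i) * (y' i j : ℝ))) ≤
        Real.exp (c * (u - t)) * (c * x u j + ∑ i, k i * (mono (x (u - τ i)) (y i) * (y' i j : ℝ) - mono (x u) (y i) * (y i j : ℝ))) :=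
        mul_le_mul_of_nonneg_left (by linarith) (by linarith)
      have h6 := mul_le_mul_of_nonneg_right h3 h4
      linarith) (by linarith)
  have h1 := h.Pmono i (t + 1) (t + (τm + 1) - τ i) (by linarith) (by linarith [h.hτm i])
  have h2 := mul_le_mul_of_nonneg_left h1 (mul_nonneg hki hy)
  have h3 := (h.pos t (by linarith) j).le
  simp only [sub_self, mul_zero, Real.exp_zero, one_mul, add_sub_cancel_left] at key
  linarith

theorem mono_le_P (h : Sys y y' k τ τm x P c M N) (i : Fin r) (t : ℝ) (ht : 0 ≤ t) :
    mono (x t) (y i) ≤ Real.exp c ^ N * (P i (t + 1) - P i t) := by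
  have h0 := h.hτm0
  have hD : ∀ u ≥ t, HasDerivAt (fun u => Real.exp c ^ N * P i u - mono (x t) (y i) * (u - t))
      (Real.exp c ^ N * mono (x u) (y i) - mono (x t) (y i) * 1) u := by
    intro u hu
    exact ((h.hP i u (ht.trans hu)).const_mul _).sub (((hasDerivAt_id u).sub_const t).const_mul _)
  have key := monoOn_of_deriv (a := t) (b := t + 1)
    (fun u hu => (hD u hu.1).continuousAt.continuousWithinAt) (fun u hu => hD u hu.1.le)
    (by
      intro u hu
      have hu1 := hu.1
      have hu2 := hu.2
      have := mono_comp (C := Real.exp c) (Real.one_le_exp h.hc) (fun j => (h.pos t (by linarith) j).le)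
        (fun j => (h.pos u (by linarith) j).le) (y i) N (h.hN i) (fun j _ => by
          refine (h.dec t u ht hu1.le j).trans ?_
          refine mul_le_mul_of_nonneg_right ?_ (h.pos u (by linarith) j).le
          refine Real.exp_le_exp.2 ?_
          have := mul_le_mul_of_nonneg_left (show u - t ≤ 1 by linarith) h.hc
          linarith)
      linarith) (by linarith)
  simp only [sub_self, mul_zero, add_sub_cancel_left] at key
  linarith

theorem dec' (h : Sys y y' k τ τm x P c M N) (s t : ℝ) (hs : 0 ≤ s) (hst : s ≤ t) (D : ℝ)
    (hD : t - s ≤ D) (j : Fin n) : x s j ≤ Real.exp (c * D) * x t j := by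
  refine (h.dec s t hs hst j).trans ?_
  refine mul_le_mul_of_nonneg_right ?_ (h.pos t (by linarith [h.hτm0]) j).le
  exact Real.exp_le_exp.2 (mul_le_mul_of_nonneg_left hD h.hc)

theorem P_le (h : Sys y y' k τ τm x P c M N) (i : Fin r) (j : Fin n) (hij : y i j ≠ 0) (t : ℝ)
    (ht : τm ≤ t) :
    P i t - P i (t - τ i) ≤ τm * (M ^ N * (Real.exp (c * τm) * x t j)) := by
  have h0 := h.hτm0
  have h1 := h.hτm i
  have h2 := h.hτ i
  set A := M ^ N * (Real.exp (c * τm) * x t j) with hA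
  have hMN : 0 ≤ M ^ N := pow_nonneg (by linarith [h.hM]) _
  have hA0 : 0 ≤ A := mul_nonneg hMN (mul_nonneg (Real.exp_pos _).le (h.pos t (by linarith) j).le)
  have hD : ∀ u ≥ t - τ i, HasDerivAt (fun u => A * u - P i u) (A * 1 - mono (x u) (y i)) u := by
    intro u hu
    exact ((hasDerivAt_id u).const_mul _).sub (h.hP i u (by linarith))
  have key := monoOn_of_deriv (a := t - τ i) (b := t)
    (fun u hu => (hD u hu.1).continuousAt.continuousWithinAt) (fun u hu => hD u hu.1.le)
    (by
      intro u hu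
      have hu1 := hu.1
      have hu2 := hu.2
      have h3 := mono_le_single h.hM (fun j => (h.pos u (by linarith) j).le) (h.bd u (by linarith)) (y i) N (h.hN i) j hij
      have h4 := mul_le_mul_of_nonneg_left (h.dec' u t (by linarith) hu2.le τm (by linarith) j) hMN
      linarith) (by linarith)
  have := mul_le_mul_of_nonneg_right h1 hA0
  linarith

end Sys
end GP

open Finset Filter
namespace GP
namespace Sys
variable {n r : ℕ} {y y' : Fin r → Fin n → ℕ} {k τ : Fin r → ℝ} {τm : ℝ}
    {x : ℝ → Fin n → ℝ} {P : Fin r → ℝ → ℝ} {c M : ℝ} {N : ℕ}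

theorem flux (h : Sys y y' k τ τm x P c M N) (C D KY : ℝ) (hC : 1 ≤ C)
    (hKY : ∀ i j, k i * (y' i j : ℝ) ≤ KY)
    (t : ℝ) (ht : τm + 1 ≤ t) (I : Finset (Fin n))
    (hI : ∀ l ∈ I, ∀ s, t ≤ s → s ≤ t + (τm + 1) + D → x s l ≤ C * x t l)
    (s : ℝ) (hs : t ≤ s) (hs' : s ≤ t + (τm + 1) + D) (i : Fin r) (j : Fin n) (hj : j ∈ Iᶜ) :
    k i * (y' i j : ℝ) * mono (x s) (y i) ≤ KY * M ^ N * (∑ j ∈ Iᶜ, x s j) +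
      C ^ N * Real.exp c ^ N * Real.exp (c * (τm + 1)) * ∑ j ∈ Iᶜ, x (t + (τm + 1)) j := by
  have h0 := h.hτm0
  have hki := (h.hk i).le
  have hy : (0:ℝ) ≤ y' i j := Nat.cast_nonneg _
  have hky := mul_nonneg hki hy
  have hKY0 : 0 ≤ KY := hky.trans (hKY i j)
  have hMN : 0 ≤ M ^ N := pow_nonneg (by linarith [h.hM]) _
  have hCN : 0 ≤ C ^ N := pow_nonneg (by linarith) _
  have hE := Real.exp_pos (c * (τm + 1))
  have hEN : 0 ≤ Real.exp c ^ N := pow_nonneg (Real.exp_pos _).le _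
  have p1 : ∀ u, -τm ≤ u → ∀ j ∈ Iᶜ, x u j ≤ ∑ j ∈ Iᶜ, x u j := fun u hu j hj =>
    Finset.single_le_sum (f := fun j => x u j) (fun l _ => (h.pos u hu l).le) hj
  have p2 : ∀ u, -τm ≤ u → 0 ≤ ∑ j ∈ Iᶜ, x u j := fun u hu =>
    Finset.sum_nonneg fun l _ => (h.pos u hu l).le
  have q1 := p2 s (by linarith)
  have q2 := p2 (t + (τm + 1)) (by linarith)
  by_cases hc : ∃ l ∈ Iᶜ, y i l ≠ 0
  · obtain ⟨l, hl, hil⟩ := hc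
    have h1 := mono_le_single h.hM (fun j => (h.pos s (by linarith) j).le) (h.bd s (by linarith)) (y i) N (h.hN i) l hil
    have h2 := h1.trans (mul_le_mul_of_nonneg_left (p1 s (by linarith) l hl) hMN)
    have h3 := mul_le_mul (hKY i j) h2 (h.mp s (by linarith) i).le hKY0
    have h4 : 0 ≤ C ^ N * Real.exp c ^ N * Real.exp (c * (τm + 1)) * ∑ j ∈ Iᶜ, x (t + (τm + 1)) j := by
      positivity
    linarith
  · push Not at hc
    have h1 := mono_comp hC (fun j => (h.pos s (by linarith) j).le)
      (fun j => (h.pos t (by linarith) j).le) (y i) N (h.hN i) (fun l hl => by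
        refine hI l ?_ s hs hs'
        by_contra hlI
        exact hl (hc l (Finset.mem_compl.2 hlI)))
    have h2 := mul_le_mul_of_nonneg_left (h.mono_le_P i t (by linarith)) hCN
    have h3 := mul_le_mul_of_nonneg_left (h1.trans h2) hky
    have h4 := h.arr i j t ht
    have h5 := mul_le_mul_of_nonneg_left (h.Pmono i (t - τ i) t (by linarith [h.hτm i]) (by linarith [h.hτ i])) hky
    have h6 : k i * (y' i j : ℝ) * (P i (t + 1) - P i t) ≤
      Real.exp (c * (τm + 1)) * ∑ j ∈ Iᶜ, x (t + (τm + 1)) j := by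
      have := mul_le_mul_of_nonneg_left (p1 (t + (τm + 1)) (by linarith) j hj) hE.le
      linarith
    have h7 := mul_le_mul_of_nonneg_left h6 (mul_nonneg hCN hEN)
    have h8 : 0 ≤ KY * M ^ N * (∑ j ∈ Iᶜ, x s j) := by positivity
    linarith

theorem step (h : Sys y y' k τ τm x P c M N) (C D : ℝ) (hC : 1 ≤ C) (hD : 0 ≤ D) :
    ∃ C' ≥ 1, ∀ t ≥ τm + 1, ∀ I : Finset (Fin n), I ≠ Finset.univ →
      (∀ l ∈ I, ∀ s, t ≤ s → s ≤ t + (τm + 1) + D → x s l ≤ C * x t l) →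
      ∃ l1, l1 ∉ I ∧ ∀ l ∈ insert l1 I, ∀ s, t + (τm + 1) ≤ s → s ≤ t + (τm + 1) + D →
        x s l ≤ C' * x (t + (τm + 1)) l := by
  have h0 := h.hτm0
  set KY := ∑ i, ∑ j, k i * (y' i j : ℝ) with hKYd
  have hkyn : ∀ i j, 0 ≤ k i * (y' i j : ℝ) := fun i j => mul_nonneg (h.hk i).le (Nat.cast_nonneg _)
  have hKY : ∀ i j, k i * (y' i j : ℝ) ≤ KY := fun i j =>
    (Finset.single_le_sum (f := fun j => k i * (y' i j : ℝ)) (fun j _ => hkyn i j) (Finset.mem_univ j)).trans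
    (Finset.single_le_sum (f := fun i => ∑ j, k i * (y' i j : ℝ))
      (fun i _ => Finset.sum_nonneg fun j _ => hkyn i j) (Finset.mem_univ i))
  have hKY0 : 0 ≤ KY := Finset.sum_nonneg fun i _ => Finset.sum_nonneg fun j _ => hkyn i j
  have hMN : 0 ≤ M ^ N := pow_nonneg (by linarith [h.hM]) _
  have hCN : 0 ≤ C ^ N := pow_nonneg (by linarith) _
  set E := Real.exp (c * (τm + 1)) with hEd
  have hE : 0 < E := Real.exp_pos _
  have hE1 : 1 ≤ E := Real.one_le_exp (mul_nonneg h.hc (by linarith))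
  have hEN : 0 ≤ Real.exp c ^ N := pow_nonneg (Real.exp_pos _).le _
  set C1 : ℝ := n * r * (KY * M ^ N) + 1 with hC1
  set C2 : ℝ := n * r * (C ^ N * Real.exp c ^ N * E) with hC2
  have hC1p : 1 ≤ C1 := by
    have : 0 ≤ (n:ℝ) * r * (KY * M ^ N) := by positivity
    linarith
  have hC2p : 0 ≤ C2 := by positivity
  set Q := Real.exp (C1 * (τm + 1 + D)) * (E + r * E + C2) * n with hQ
  have hQ0 : 0 ≤ Q := by positivity
  refine ⟨C * E + Q, by nlinarith, ?_⟩
  intro t ht I hIne hI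
  have hJ : (Iᶜ).Nonempty := by
    rw [Finset.nonempty_iff_ne_empty, Ne, Finset.compl_eq_empty_iff]; exact hIne
  obtain ⟨l1, hl1, hmax⟩ := Finset.exists_max_image Iᶜ (fun j => x (t + (τm + 1)) j) hJ
  refine ⟨l1, Finset.mem_compl.1 hl1, ?_⟩
  intro l hl s hs hs'
  have hxl := h.pos (t + (τm + 1)) (by linarith) l
  rcases Finset.mem_insert.1 hl with rfl | hlI
  swap
  · have h1 := hI l hlI s (by linarith) hs'
    have h2 := h.dec' t (t + (τm + 1)) (by linarith) (by linarith) (τm + 1) (by linarith) l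
    have h3 := mul_le_mul_of_nonneg_left h2 (show 0 ≤ C by linarith)
    have h4 := mul_nonneg hQ0 hxl.le
    linarith
  set S := ∑ j ∈ Iᶜ, x (t + (τm + 1)) j with hS
  have hcard : ((Iᶜ.card : ℕ) : ℝ) ≤ n := by
    exact_mod_cast (Finset.card_le_univ Iᶜ).trans (by simp)
  have hSl : S ≤ n * x (t + (τm + 1)) l := by
    have := Finset.sum_le_card_nsmul Iᶜ (fun j => x (t + (τm + 1)) j) _ hmax
    rw [nsmul_eq_mul] at this
    exact this.trans (mul_le_mul_of_nonneg_right hcard hxl.le)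
  have hS0 : 0 ≤ S := Finset.sum_nonneg fun j _ => (h.pos _ (by linarith) j).le
  set g : ℝ → ℝ := fun s => ∑ j ∈ Iᶜ, (x s j + ∑ i, k i * (y' i j : ℝ) * (P i s - P i (s - τ i))) with hg
  have hPn : ∀ s ≥ t, ∀ j, 0 ≤ ∑ i, k i * (y' i j : ℝ) * (P i s - P i (s - τ i)) := by
    intro s hs j
    refine Finset.sum_nonneg fun i _ => mul_nonneg (hkyn i j) ?_
    linarith [h.Pmono i (s - τ i) s (by linarith [h.hτm i]) (by linarith [h.hτ i])]
  have hgx : ∀ s ≥ t, ∑ j ∈ Iᶜ, x s j ≤ g s := fun s hs =>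
    Finset.sum_le_sum fun j _ => by linarith [hPn s hs j]
  have hg0 : ∀ s ≥ t, 0 ≤ ∑ j ∈ Iᶜ, x s j := fun s hs =>
    Finset.sum_nonneg fun j _ => (h.pos _ (by linarith) j).le
  have hgt : g t ≤ (E + r * E) * S := by
    rw [hS, Finset.mul_sum]
    refine Finset.sum_le_sum fun j _ => ?_
    have h2 := h.dec' t (t + (τm + 1)) (by linarith) (by linarith) (τm + 1) (by linarith) j
    have h3 : ∑ i, k i * (y' i j : ℝ) * (P i t - P i (t - τ i)) ≤ ∑ i : Fin r, E * x (t + (τm + 1)) j := by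
      refine Finset.sum_le_sum fun i _ => ?_
      have h4 := h.arr i j t ht
      have h5 := mul_le_mul_of_nonneg_left (h.Pmono i t (t + 1) (by linarith) (by linarith)) (hkyn i j)
      linarith
    simp only [Finset.sum_const, Finset.card_univ, Fintype.card_fin, nsmul_eq_mul] at h3
    linarith
  set g' : ℝ → ℝ := fun s => ∑ j ∈ Iᶜ, ∑ i, k i * mono (x s) (y i) * ((y' i j : ℝ) - y i j) with hg'
  have hgd : ∀ s ≥ t, HasDerivAt g (g' s) s := by
    intro s hs
    refine HasDerivAt.fun_sum fun j _ => ?_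
    have h1 := h.hx j s (by linarith)
    have h2 : HasDerivAt (fun s => ∑ i, k i * (y' i j : ℝ) * (P i s - P i (s - τ i)))
        (∑ i, k i * (y' i j : ℝ) * (mono (x s) (y i) - mono (x (s - τ i)) (y i))) s :=
      HasDerivAt.fun_sum fun i _ => ((h.hP i s (by linarith)).sub (h.hPs i s (by linarith))).const_mul _
    refine (h1.add h2).congr_deriv ?_
    rw [← Finset.sum_add_distrib]
    refine Finset.sum_congr rfl fun i _ => ?_
    ring
  have hg'le : ∀ s, t ≤ s → s ≤ t + (τm + 1) + D → g' s ≤ C1 * (g s + C2 * S) := by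
    intro s hs hs'
    set Z := KY * M ^ N * (∑ j ∈ Iᶜ, x s j) + C ^ N * Real.exp c ^ N * E * S with hZ
    have hG := hg0 s hs
    have hZ0 : 0 ≤ Z := by positivity
    have h1 : g' s ≤ ∑ j ∈ Iᶜ, ∑ i : Fin r, Z := by
      refine Finset.sum_le_sum fun j hj => Finset.sum_le_sum fun i _ => ?_
      have h2 := h.flux C D KY hC hKY t ht I hI s hs hs' i j hj
      have h3 : 0 ≤ k i * mono (x s) (y i) * (y i j : ℝ) :=
        mul_nonneg (mul_nonneg (h.hk i).le (h.mp s (by linarith) i).le) (Nat.cast_nonneg _)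
      have h4 : k i * mono (x s) (y i) * ((y' i j : ℝ) - y i j) = k i * (y' i j : ℝ) * mono (x s) (y i) -
        k i * mono (x s) (y i) * (y i j : ℝ) := by ring
      rw [h4]
      linarith
    simp only [Finset.sum_const, Finset.card_univ, Fintype.card_fin, nsmul_eq_mul] at h1
    have h2 : (Iᶜ.card : ℝ) * (r * Z) ≤ n * (r * Z) :=
      mul_le_mul_of_nonneg_right hcard (by positivity)
    have h3 : (n:ℝ) * (r * Z) = (C1 - 1) * (∑ j ∈ Iᶜ, x s j) + C2 * S := by
      rw [hZ, hC1, hC2]; ring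
    have h4 := hgx s hs
    have h5 : C1 * (∑ j ∈ Iᶜ, x s j) ≤ C1 * g s := mul_le_mul_of_nonneg_left h4 (by linarith)
    have h6 : 1 * (C2 * S) ≤ C1 * (C2 * S) := mul_le_mul_of_nonneg_right hC1p (by positivity)
    linarith
  have hd : ∀ u ≥ t, HasDerivAt (fun u => -(Real.exp (C1 * (t - u)) * (g u + C2 * S)))
      (-(-(Real.exp (C1 * (t - u)) * C1) * (g u + C2 * S) + Real.exp (C1 * (t - u)) * g' u)) u := by
    intro u hu
    have he : HasDerivAt (fun u => Real.exp (C1 * (t - u))) (-(Real.exp (C1 * (t - u)) * C1)) u := by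
      have := (((hasDerivAt_id u).const_sub t).const_mul C1).exp
      simpa using this
    exact (he.mul ((hgd u hu).add_const _)).neg
  have key := monoOn_of_deriv (a := t) (b := s)
    (fun u hu => (hd u hu.1).continuousAt.continuousWithinAt) (fun u hu => hd u hu.1.le)
    (by
      intro u hu
      have h1 := mul_le_mul_of_nonneg_left (hg'le u hu.1.le (by linarith [hu.2]))
        (Real.exp_pos (C1 * (t - u))).le
      linarith) (by linarith)
  simp only [sub_self, mul_zero, Real.exp_zero, one_mul, neg_le_neg_iff] at key
  have hxs : x s l ≤ g s :=
    (Finset.single_le_sum (f := fun j => x s j) (fun j _ => (h.pos s (by linarith) j).le) hl1).trans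
      (hgx s (by linarith))
  have e1 : Real.exp (C1 * (s - t)) * (Real.exp (C1 * (t - s)) * (g s + C2 * S)) = g s + C2 * S := by
    rw [← mul_assoc, ← Real.exp_add]
    rw [show C1 * (s - t) + C1 * (t - s) = 0 by ring, Real.exp_zero, one_mul]
  have h1 := mul_le_mul_of_nonneg_left key (Real.exp_pos (C1 * (s - t))).le
  rw [e1] at h1
  have h2 : Real.exp (C1 * (s - t)) * (g t + C2 * S) ≤
      Real.exp (C1 * (τm + 1 + D)) * ((E + r * E + C2) * (n * x (t + (τm + 1)) l)) := by
    refine mul_le_mul (Real.exp_le_exp.2 (mul_le_mul_of_nonneg_left (by linarith) (by linarith))) ?_ ?_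
      (Real.exp_pos _).le
    · have h3 : (E + r * E + C2) * S ≤ (E + r * E + C2) * (n * x (t + (τm + 1)) l) :=
        mul_le_mul_of_nonneg_left hSl (by positivity)
      linarith
    · have := hgx t le_rfl
      have := hg0 t le_rfl
      have := mul_nonneg hC2p hS0
      linarith
  have h3 : 0 ≤ C2 * S := mul_nonneg hC2p hS0
  have h4 : 0 ≤ C * E * x (t + (τm + 1)) l := by positivity
  have h5 : Q * x (t + (τm + 1)) l = Real.exp (C1 * (τm + 1 + D)) * ((E + r * E + C2) * (n * x (t + (τm + 1)) l)) := by
    rw [hQ]; ring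
  linarith

theorem jump (h : Sys y y' k τ τm x P c M N) :
    ∃ C ≥ 1, ∃ T ≥ τm, ∀ t ≥ T, ∀ s, t - τm ≤ s → s ≤ t → ∀ j, x t j ≤ C * x s j := by
  have h0 := h.hτm0
  have main : ∀ m ≤ n, ∃ C ≥ (1:ℝ), ∀ a ≥ τm + 1, ∃ I : Finset (Fin n), m ≤ I.card ∧
      ∀ l ∈ I, ∀ s, a + m * (τm + 1) ≤ s → s ≤ a + n * (τm + 1) + τm →
        x s l ≤ C * x (a + m * (τm + 1)) l := by
    intro m
    induction m with
    | zero =>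
      intro _
      exact ⟨1, le_rfl, fun a _ => ⟨∅, by simp, by simp⟩⟩
    | succ m ih =>
      intro hm
      obtain ⟨C, hC, hCa⟩ := ih (by omega)
      have hmn : ((m:ℝ) + 1) ≤ n := by exact_mod_cast hm
      have hpos : 0 ≤ ((n:ℝ) - (m + 1)) * (τm + 1) := mul_nonneg (by linarith) (by linarith)
      obtain ⟨C', hC', hstep⟩ := h.step C (((n:ℝ) - (m + 1)) * (τm + 1) + τm) hC (by linarith)
      have hE1 : 1 ≤ Real.exp (c * (τm + 1)) := Real.one_le_exp (mul_nonneg h.hc (by linarith))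
      have hCE : 0 ≤ C * Real.exp (c * (τm + 1)) := by positivity
      refine ⟨C' + C * Real.exp (c * (τm + 1)), by linarith, fun a ha => ?_⟩
      obtain ⟨I, hIc, hI⟩ := hCa a ha
      have hmp : 0 ≤ (m:ℝ) * (τm + 1) := mul_nonneg (Nat.cast_nonneg _) (by linarith)
      have e1 : a + ((m + 1 : ℕ) : ℝ) * (τm + 1) = a + m * (τm + 1) + (τm + 1) := by push_cast; ring
      have e2 : a + m * (τm + 1) + (τm + 1) + (((n:ℝ) - (m + 1)) * (τm + 1) + τm) =
        a + n * (τm + 1) + τm := by ring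
      by_cases hu : I = Finset.univ
      · refine ⟨I, by rw [hu]; simpa using hm, fun l hl s hs hs' => ?_⟩
        rw [e1] at hs ⊢
        have h1 := hI l hl s (by linarith) hs'
        have h2 := h.dec' (a + m * (τm + 1)) (a + m * (τm + 1) + (τm + 1)) (by linarith) (by linarith)
          (τm + 1) (by linarith) l
        have h3 := mul_le_mul_of_nonneg_left h2 (show 0 ≤ C by linarith)
        have h4 : 0 ≤ C' * x (a + m * (τm + 1) + (τm + 1)) l :=
          mul_nonneg (by linarith) (h.pos _ (by linarith) l).le
        linarith
      · obtain ⟨l1, hl1, hl⟩ := hstep (a + m * (τm + 1)) (by linarith) I hu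
          (fun l hl s hs hs' => hI l hl s hs (by linarith))
        refine ⟨insert l1 I, by rw [Finset.card_insert_of_notMem hl1]; omega, fun l hl' s hs hs' => ?_⟩
        rw [e1] at hs ⊢
        have h1 := hl l hl' s hs (by linarith)
        have h4 : 0 ≤ C * Real.exp (c * (τm + 1)) * x (a + m * (τm + 1) + (τm + 1)) l :=
          mul_nonneg hCE (h.pos _ (by linarith) l).le
        linarith
  obtain ⟨C, hC, hCa⟩ := main n le_rfl
  have hnp : 0 ≤ (n:ℝ) * (τm + 1) := mul_nonneg (Nat.cast_nonneg _) (by linarith)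
  have hE1 : 1 ≤ Real.exp (c * τm) := Real.one_le_exp (mul_nonneg h.hc (by linarith))
  refine ⟨C * Real.exp (c * τm), by nlinarith, τm + 1 + n * (τm + 1) + τm, by linarith, ?_⟩
  intro t ht s hs hs' j
  obtain ⟨I, hIc, hI⟩ := hCa (t - τm - n * (τm + 1)) (by linarith)
  have hu : I = Finset.univ := by
    refine Finset.eq_univ_of_card I ?_
    have := Finset.card_le_univ I
    simp only [Fintype.card_fin] at this ⊢
    omega
  have h1 := hI j (by rw [hu]; simp) t (by linarith) (by linarith)
  rw [show t - τm - n * (τm + 1) + n * (τm + 1) = t - τm by ring] at h1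
  have h2 := h.dec' (t - τm) s (by linarith) hs τm (by linarith) j
  have h3 := mul_le_mul_of_nonneg_left h2 (show 0 ≤ C by linarith)
  linarith

end Sys
end GP

open Finset Filter
namespace GP

theorem lower {n r : ℕ} (hn : 1 ≤ n) {y y' : Fin r → Fin n → ℕ} {k τ : Fin r → ℝ} {τm : ℝ}
    {x : ℝ → Fin n → ℝ} {P : Fin r → ℝ → ℝ} {c M : ℝ} {N : ℕ}
    (h : Sys y y' k τ τm x P c M N) (hCB : ComplexBalancedOn y y' k Finset.univ) :
    ∃ ε > 0, ∃ t0, ∀ t ≥ t0, ∀ j, ε ≤ x t j := by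
  have h0 := h.hτm0
  obtain ⟨xb, hxb, hbal⟩ := hCB
  obtain ⟨CJ, hCJ, T, hT, hjump⟩ := h.jump
  have hMN : 0 ≤ M ^ N := pow_nonneg (by linarith [h.hM]) _
  set Y : ℝ → Fin n → ℝ := fun t j => x t j + ∑ i, k i * (y i j : ℝ) * (P i t - P i (t - τ i)) with hY
  set Y' : ℝ → Fin n → ℝ := fun t j => ∑ i, k i * mono (x (t - τ i)) (y i) * ((y' i j : ℝ) - y i j) with hY'
  set t0 := T + 1 with ht0
  have hkyn : ∀ i j, 0 ≤ k i * (y i j : ℝ) := fun i j => mul_nonneg (h.hk i).le (Nat.cast_nonneg _)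
  have hder : ∀ t ≥ t0, HasDerivAt Y (Y' t) t := by
    intro t ht
    rw [hasDerivAt_pi]
    intro j
    have h1 := h.hx j t (by linarith)
    have h2 : HasDerivAt (fun s => ∑ i, k i * (y i j : ℝ) * (P i s - P i (s - τ i)))
        (∑ i, k i * (y i j : ℝ) * (mono (x t) (y i) - mono (x (t - τ i)) (y i))) t :=
      HasDerivAt.fun_sum fun i _ => ((h.hP i t (by linarith)).sub (h.hPs i t (by linarith))).const_mul _
    refine (h1.add h2).congr_deriv ?_
    rw [← Finset.sum_add_distrib]
    refine Finset.sum_congr rfl fun i _ => ?_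
    ring
  have hxY : ∀ t ≥ t0, ∀ j, x t j ≤ Y t j := by
    intro t ht j
    have : 0 ≤ ∑ i, k i * (y i j : ℝ) * (P i t - P i (t - τ i)) := by
      refine Finset.sum_nonneg fun i _ => mul_nonneg (hkyn i j) ?_
      linarith [h.Pmono i (t - τ i) t (by linarith [h.hτm i]) (by linarith [h.hτ i])]
    show x t j ≤ x t j + _
    linarith
  set CY : ℝ := 1 + (∑ i, k i * N) * (τm * (M ^ N * Real.exp (c * τm))) with hCY
  have hskN : 0 ≤ ∑ i, k i * (N : ℝ) :=
    Finset.sum_nonneg fun i _ => mul_nonneg (h.hk i).le (Nat.cast_nonneg _)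
  have hCY1 : 1 ≤ CY := by
    have : 0 ≤ (∑ i, k i * (N:ℝ)) * (τm * (M ^ N * Real.exp (c * τm))) := by positivity
    linarith
  have hYx : ∀ t ≥ t0, ∀ j, Y t j ≤ CY * x t j := by
    intro t ht j
    have hxp := (h.pos t (by linarith) j).le
    set A := τm * (M ^ N * (Real.exp (c * τm) * x t j)) with hA
    have hA0 : 0 ≤ A := by positivity
    have : ∑ i, k i * (y i j : ℝ) * (P i t - P i (t - τ i)) ≤ ∑ i, k i * N * A := by
      refine Finset.sum_le_sum fun i _ => ?_
      by_cases hij : y i j = 0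
      · simp only [hij, Nat.cast_zero, mul_zero, zero_mul]
        exact mul_nonneg (mul_nonneg (h.hk i).le (Nat.cast_nonneg _)) hA0
      · have h2 : (y i j : ℝ) ≤ N := by
          exact_mod_cast (Finset.single_le_sum (f := y i) (fun _ _ => Nat.zero_le _) (Finset.mem_univ j)).trans (h.hN i)
        have h3 := h.P_le i j hij t (by linarith)
        exact (mul_le_mul_of_nonneg_left h3 (hkyn i j)).trans
          (mul_le_mul_of_nonneg_right (mul_le_mul_of_nonneg_left h2 (h.hk i).le) hA0)
    rw [← Finset.sum_mul] at this
    show x t j + _ ≤ _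
    rw [hCY]
    linarith
  have hYpos : ∀ t ≥ t0, ∀ j, 0 < Y t j := fun t ht j =>
    lt_of_lt_of_le (h.pos t (by linarith) j) (hxY t ht j)
  have hYK : ∀ t ≥ t0, ∀ j, Y t j ≤ Real.exp (Real.log (CY * M)) := by
    intro t ht j
    rw [Real.exp_log (mul_pos (by linarith) (by linarith [h.hM]))]
    exact (hYx t ht j).trans (mul_le_mul_of_nonneg_left (h.bd t (by linarith) j) (by linarith))
  -- comparison of monomials
  set Λ : ℝ := CY * CJ * Real.exp (c * τm) with hΛ
  have hE1 : 1 ≤ Real.exp (c * τm) := Real.one_le_exp (mul_nonneg h.hc h0)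
  have hCC : 1 ≤ CY * CJ := one_le_mul_of_one_le_of_one_le hCY1 hCJ
  have hΛ1 : 1 ≤ Λ := one_le_mul_of_one_le_of_one_le hCC hE1
  have hv1 : ∀ t ≥ t0, ∀ i, mono (x (t - τ i)) (y i) ≤ Λ ^ N * mono (Y t) (y i) := by
    intro t ht i
    have := h.hτm i
    have := h.hτ i
    refine mono_comp hΛ1 (fun j => (h.pos _ (by linarith) j).le) (fun j => (hYpos t ht j).le) _ N (h.hN i) ?_
    intro j _
    have h1 := h.dec' (t - τ i) t (by linarith) (by linarith) τm (by linarith) j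
    refine h1.trans (mul_le_mul ?_ (hxY t ht j) (h.pos t (by linarith) j).le (by linarith))
    exact le_mul_of_one_le_left (by linarith) hCC
  have hv2 : ∀ t ≥ t0, ∀ i, mono (Y t) (y i) ≤ Λ ^ N * mono (x (t - τ i)) (y i) := by
    intro t ht i
    have := h.hτm i
    have := h.hτ i
    refine mono_comp hΛ1 (fun j => (hYpos t ht j).le) (fun j => (h.pos _ (by linarith) j).le) _ N (h.hN i) ?_
    intro j _
    have hxp := (h.pos (t - τ i) (by linarith) j).le
    have h1 := hjump t (by linarith) (t - τ i) (by linarith) (by linarith) j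
    have h2 := mul_le_mul_of_nonneg_left h1 (show 0 ≤ CY by linarith)
    have h3 := hYx t ht j
    have h4 : CY * CJ ≤ Λ := le_mul_of_one_le_right (by linarith) hE1
    have h5 := mul_le_mul_of_nonneg_right h4 hxp
    linarith
  set N0 : ℕ := N + 1 with hN0
  set b : Fin r → ℝ := fun i => mono xb (y i) with hb
  have hbp : ∀ i, 0 < b i := fun i => mono_pos hxb _
  set R : ℝ := 1 + ∑ i, ∑ i', b i' / b i with hR
  have hbb : ∀ i i', b i' / b i ≤ R := by
    intro i i'
    have hp : ∀ i i', 0 ≤ b i' / b i := fun i i' => (div_pos (hbp i') (hbp i)).le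
    have h1 := (Finset.single_le_sum (f := fun i' => b i' / b i) (fun i' _ => hp i i') (Finset.mem_univ i')).trans
      (Finset.single_le_sum (f := fun i => ∑ i', b i' / b i)
        (fun i _ => Finset.sum_nonneg fun i' _ => hp i i') (Finset.mem_univ i))
    linarith
  have hRp : 0 < R := by
    have : 0 ≤ ∑ i, ∑ i', b i' / b i := Finset.sum_nonneg fun i _ => Finset.sum_nonneg fun i' _ =>
      (div_pos (hbp i') (hbp i)).le
    linarith
  have hLp : 0 < Λ ^ N := pow_pos (by linarith) _
  set δ : ℝ := Real.log (R * (Λ ^ N * Λ ^ N)) with hδ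
  have H : ∀ t ≥ t0, ∀ ξ : Fin n → ℝ,
      (∀ d : Fin n → ℤ, (∀ j, |d j| ≤ N0) → 0 < ∑ j, (d j : ℝ) * ξ j →
        δ ≤ ∑ j, (d j : ℝ) * (-Real.log (Y t j))) → 0 ≤ ∑ j, Y' t j * ξ j := by
    intro t ht ξ hξ
    set v : Fin r → ℝ := fun i => mono (x (t - τ i)) (y i) with hv
    have hvp : ∀ i, 0 < v i := fun i => h.mp _ (by linarith [h.hτm i]) i
    have hcut := cut_sum (fun i => ∑ j, (y i j : ℝ) * ξ j) (fun i => ∑ j, (y' i j : ℝ) * ξ j)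
      (fun i => k i * b i) (fun i => v i / b i) (fun i => mul_pos (h.hk i) (hbp i))
      (fun i => div_pos (hvp i) (hbp i))
      (fun F => cb_sum y y' (fun i => k i * b i) hbal (fun η => F (∑ j, (η j : ℝ) * ξ j)))
      (by
        intro i i' hlt
        have hle : ∀ i j, y i j ≤ N := fun i j =>
          (Finset.single_le_sum (f := y i) (fun _ _ => Nat.zero_le _) (Finset.mem_univ j)).trans (h.hN i)
        have h1 := hξ (fun j => (y i j : ℤ) - (y i' j : ℤ)) (by
          intro j
          have := hle i j
          have := hle i' j
          rw [abs_le]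
          constructor <;> omega) (by
          push_cast
          simp only [sub_mul, Finset.sum_sub_distrib]
          linarith)
        push_cast at h1
        simp only [sub_mul, Finset.sum_sub_distrib, mul_neg, Finset.sum_neg_distrib] at h1
        rw [← log_mono (hYpos t ht), ← log_mono (hYpos t ht)] at h1
        have hmi := mono_pos (hYpos t ht) (y i)
        have hmi' := mono_pos (hYpos t ht) (y i')
        have h2 : R * (Λ ^ N * Λ ^ N) * mono (Y t) (y i) ≤ mono (Y t) (y i') := by
          rw [← Real.log_le_log_iff (by positivity) hmi', Real.log_mul (by positivity) hmi.ne']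
          linarith
        have h3 := hv1 t ht i
        have h4 := hv2 t ht i'
        have h5 : R * v i ≤ v i' := by
          have a1 : R * (Λ ^ N * v i) ≤ R * (Λ ^ N * (Λ ^ N * mono (Y t) (y i))) :=
            mul_le_mul_of_nonneg_left (mul_le_mul_of_nonneg_left h3 hLp.le) hRp.le
          have a2 : Λ ^ N * (R * v i) ≤ Λ ^ N * v i' := by linarith
          exact le_of_mul_le_mul_left a2 hLp
        rw [div_le_div_iff₀ (hbp i) (hbp i')]
        have h6 := hbb i i'
        rw [div_le_iff₀ (hbp i)] at h6
        calc v i * b i' ≤ v i * (R * b i) := mul_le_mul_of_nonneg_left h6 (hvp i).le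
          _ = (R * v i) * b i := by ring
          _ ≤ _ := mul_le_mul_of_nonneg_right h5 (hbp i).le)
    refine hcut.trans (le_of_eq ?_)
    simp only [hY', Finset.sum_mul]
    rw [Finset.sum_comm]
    refine Finset.sum_congr rfl fun i _ => ?_
    rw [← Finset.sum_sub_distrib, Finset.mul_sum]
    refine Finset.sum_congr rfl fun j _ => ?_
    have := (hbp i).ne'
    simp only [hv]
    field_simp
  obtain ⟨ε, hε, hεY⟩ := static_dyn hn N0 (by omega) (Real.log (CY * M)) δ Y Y' t0 hder hYpos hYK H
  refine ⟨ε / CY, div_pos hε (by linarith), t0, fun t ht j => ?_⟩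
  rw [div_le_iff₀ (by linarith)]
  have := hεY t ht j
  have := hYx t ht j
  linarith

end GP

theorem stmt14 {n r : ℕ} (y y' : Fin r → Fin n → ℕ)
    (k τ : Fin r → ℝ) (τm : ℝ)
    (hk : ∀ i, 0 < k i) (hτ : ∀ i, 0 ≤ τ i) (hτm : ∀ i, τ i ≤ τm) (hτm0 : 0 ≤ τm)
    (hCB : ComplexBalancedOn y y' k Finset.univ)
    (W : Set (Fin n)) (hW : Semilocking y y' Finset.univ W)
    (hdim : Module.finrank ℝ
        (Submodule.span ℝ {v : {j : Fin n // j ∈ W} → ℝ |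
          ∃ i, v = fun j => (y' i j.1 : ℝ) - (y i j.1 : ℝ)}) < W.ncard)
    (x : ℝ → Fin n → ℝ) (hx : IsSolution y y' k τ τm x)
    (hxpos : PosInit τm x) (hxbdd : BoundedSol τm x)
    (θ : ℝ → Fin n → ℝ) (hθ : OmegaLimitPt τm x θ) :
    ¬ OnBoundary τm W θ := by
  intro hB
  obtain ⟨⟨j, hj⟩, _⟩ := hW
  obtain ⟨P, c, M, N, hS⟩ := GP.exists_sys y y' k τ τm hk hτ hτm hτm0 x hx hxpos hxbdd
  obtain ⟨ε, hε, t0, hlow⟩ := GP.lower (Nat.one_le_iff_ne_zero.2 (by rintro rfl; exact j.elim0)) hS hCB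
  obtain ⟨_, _, tN, htN, hconv⟩ := hθ
  obtain ⟨N₀, hN₀⟩ := hconv ε hε
  obtain ⟨m, hm1, hm2⟩ := ((htN.eventually_ge_atTop t0).and (Filter.eventually_ge_atTop N₀)).exists
  have h0 : (0:ℝ) ∈ Set.Icc (-τm) 0 := ⟨by linarith, le_rfl⟩
  have h1 := hN₀ m hm2 0 h0
  have h2 := (norm_le_pi_norm _ j).trans_lt h1
  rw [Pi.sub_apply, hB.1 0 h0 j hj, sub_zero, add_zero, Real.norm_eq_abs] at h2
  have h3 := hlow (tN m) hm1 j
  have h4 := le_abs_self (x (tN m) j)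
  linarith
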